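/- The universality problem for pebble-intervals automata is undecidable: there is no algorithm that, given a PIA A over alphabet Σ, decides whether L(A) = Σ*. Likewise the inclusion problem L(A₁) ⊆ L(A₂) is undecidable. -/

import Mathlib

/-- A pebble-intervals automaton (PIA): alphabet `α`, `m` pebbles, states `Q`,
initial state `qinit`, accepting states `F`, silent transitions `silent` and
move transitions `move q k i j a q'` where `i = none` denotes the left boundary ▷
and `j = none` denotes the right boundary ◁. -/
structure PIA (α : Type) where
  m : ℕ
  Q : Type
  qinit : Q
  F : Set Q
  silent : Q → Q → Prop
  move : Q → Fin m → Option (Fin m) → Option (Fin m) → α → Q → Prop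

/-- A configuration of a PIA on a string of length `n`: current state, pebble
assignment, and set of already-read positions. -/
structure PIAConfig {α : Type} (A : PIA α) (n : ℕ) where
  q : A.Q
  ρ : Fin A.m → Option (Fin n)
  N : Set (Fin n)

/-- Pebble `i` (or the left boundary, if `i = none`) lies strictly left of `ℓ`. -/
def leftOK {m n : ℕ} (ρ : Fin m → Option (Fin n)) (i : Option (Fin m)) (ℓ : Fin n) : Prop :=
  match i with
  | none => True
  | some p => ∃ pi, ρ p = some pi ∧ pi < ℓ

/-- Pebble `j` (or the right boundary, if `j = none`) lies strictly right of `ℓ`. -/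
def rightOK {m n : ℕ} (ρ : Fin m → Option (Fin n)) (j : Option (Fin m)) (ℓ : Fin n) : Prop :=
  match j with
  | none => True
  | some p => ∃ pj, ρ p = some pj ∧ ℓ < pj

/-- One step of a PIA on input `u`: either a silent transition, or a move
transition placing pebble `k` on an unread position strictly between `i` and `j`,
reading the letter there. -/
def PIAStep {α : Type} (A : PIA α) {n : ℕ} (u : Fin n → α)
    (c c' : PIAConfig A n) : Prop :=
  (A.silent c.q c'.q ∧ c'.ρ = c.ρ ∧ c'.N = c.N) ∨
  (∃ (k : Fin A.m) (i j : Option (Fin A.m)) (ℓ : Fin n),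
    A.move c.q k i j (u ℓ) c'.q ∧ ℓ ∉ c.N ∧
    leftOK c.ρ i ℓ ∧ rightOK c.ρ j ℓ ∧
    c'.ρ = Function.update c.ρ k (some ℓ) ∧ c'.N = insert ℓ c.N)

/-- The initial configuration: initial state, no pebbles placed, nothing read. -/
def PIAInit {α : Type} (A : PIA α) (n : ℕ) : PIAConfig A n :=
  ⟨A.qinit, fun _ => none, ∅⟩

/-- A PIA accepts a string `u` if some computation from the initial configuration
reads all positions of `u` and ends in an accepting state. -/
def PIA.Accepts {α : Type} (A : PIA α) (u : List α) : Prop :=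
  ∃ c : PIAConfig A u.length,
    Relation.ReflTransGen (PIAStep A u.get) (PIAInit A u.length) c ∧
    c.q ∈ A.F ∧ c.N = Set.univ

/-- A finite code of a PIA over the alphabet `Bool`: number of pebbles, initial
state, list of accepting states, list of silent transitions, and list of move
transitions `(q, k, i, j, a, q')`, where states are natural numbers and the
interval endpoints `i, j` encode the boundaries by `0` and pebble `p` by `p+1`. -/
abbrev PIACode : Type :=
  ℕ × ℕ × List ℕ × List (ℕ × ℕ) × List (ℕ × ℕ × ℕ × ℕ × Bool × ℕ)

/-- The PIA denoted by a code. -/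
def codeToPIA (c : PIACode) : PIA Bool where
  m := c.1
  Q := ℕ
  qinit := c.2.1
  F := {q | q ∈ c.2.2.1}
  silent := fun q q' => (q, q') ∈ c.2.2.2.1
  move := fun q k i j a q' =>
    (q, (k : ℕ),
      (match i with | none => 0 | some p => (p : ℕ) + 1),
      (match j with | none => 0 | some p => (p : ℕ) + 1),
      a, q') ∈ c.2.2.2.2

/-- Linear-grammar acceptance: the word is consumed from its left end (side `false`) or from
its right end (side `true`). -/
inductive Lin (F : List ℕ) (Sl : List (ℕ × ℕ)) (T : List (ℕ × Bool × Bool × ℕ)) :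
    ℕ → List Bool → Prop
  | nil (q : ℕ) : q ∈ F → Lin F Sl T q []
  | silent (q q' : ℕ) (v : List Bool) : (q, q') ∈ Sl → Lin F Sl T q' v → Lin F Sl T q v
  | left (q q' : ℕ) (a : Bool) (v : List Bool) : (q, false, a, q') ∈ T → Lin F Sl T q' v →
      Lin F Sl T q (a :: v)
  | right (q q' : ℕ) (a : Bool) (v : List Bool) : (q, true, a, q') ∈ T → Lin F Sl T q' v →
      Lin F Sl T q (v ++ [a])

/-- Translate a linear transition to a PIA move. -/
def mvOf (t : ℕ × Bool × Bool × ℕ) : ℕ × ℕ × ℕ × ℕ × Bool × ℕ :=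
  (t.1, (if t.2.1 then 1 else 0), 1, 2, t.2.2.1, t.2.2.2)

/-- The moves which place the two pebbles on the first and the last letter. -/
def startMoves : List (ℕ × ℕ × ℕ × ℕ × Bool × ℕ) :=
  [(0, 0, 0, 0, true, 1), (0, 0, 0, 0, false, 1), (1, 1, 1, 0, true, 2), (1, 1, 1, 0, false, 2)]

/-- The PIA of a linear grammar. -/
def build (F : List ℕ) (Sl : List (ℕ × ℕ)) (T : List (ℕ × Bool × Bool × ℕ)) : PIACode :=
  (2, 0, 0 :: 1 :: F, Sl, T.map mvOf ++ startMoves)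

/-- Endpoint code. -/
def endCode {m : ℕ} (i : Option (Fin m)) : ℕ := match i with | none => 0 | some p => (p : ℕ) + 1

theorem endCode_one {i : Option (Fin 2)} (h : endCode i = 1) : i = some 0 := by
  rcases i with _ | p
  · simp [endCode] at h
  · fin_cases p <;> simp_all [endCode]

theorem endCode_two {i : Option (Fin 2)} (h : endCode i = 2) : i = some 1 := by
  rcases i with _ | p
  · simp [endCode] at h
  · fin_cases p <;> simp_all [endCode]

theorem endCode_zero {i : Option (Fin 2)} (h : endCode i = 0) : i = none := by
  rcases i with _ | p
  · rfl
  · simp [endCode] at h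

/-- Configurations of a two-pebble automaton with concrete types. -/
@[ext] structure TC (n : ℕ) where
  q : ℕ
  a : Option (Fin n)
  b : Option (Fin n)
  N : Set (Fin n)

/-- Steps of the built automaton, concretely. -/
inductive St (Sl : List (ℕ × ℕ)) (T : List (ℕ × Bool × Bool × ℕ)) {n : ℕ} (u : Fin n → Bool) :
    TC n → TC n → Prop
  | silent {q q' a b N} : (q, q') ∈ Sl → St Sl T u ⟨q, a, b, N⟩ ⟨q', a, b, N⟩
  | left {q q' lo hi N} (ℓ : Fin n) : (q, false, u ℓ, q') ∈ T → ℓ ∉ N → lo < ℓ → ℓ < hi →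
      St Sl T u ⟨q, some lo, some hi, N⟩ ⟨q', some ℓ, some hi, insert ℓ N⟩
  | right {q q' lo hi N} (ℓ : Fin n) : (q, true, u ℓ, q') ∈ T → ℓ ∉ N → lo < ℓ → ℓ < hi →
      St Sl T u ⟨q, some lo, some hi, N⟩ ⟨q', some lo, some ℓ, insert ℓ N⟩
  | first {a b N} (ℓ : Fin n) : ℓ ∉ N → St Sl T u ⟨0, a, b, N⟩ ⟨1, some ℓ, b, insert ℓ N⟩
  | second {lo b N} (ℓ : Fin n) : ℓ ∉ N → lo < ℓ →
      St Sl T u ⟨1, some lo, b, N⟩ ⟨2, some lo, some ℓ, insert ℓ N⟩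

theorem lift_rtg {α β : Type} {r : α → α → Prop} {p : β → β → Prop} (f : α → β)
    (h : ∀ a b, r a b → p (f a) (f b)) {a b : α} (hab : Relation.ReflTransGen r a b) :
    Relation.ReflTransGen p (f a) (f b) := by
  induction hab with
  | refl => exact Relation.ReflTransGen.refl
  | tail _ hs ih => exact ih.tail (h _ _ hs)

section pia
variable {F : List ℕ} {Sl : List (ℕ × ℕ)} {T : List (ℕ × Bool × Bool × ℕ)}

/-- The PIA. -/
abbrev PA (F : List ℕ) (Sl : List (ℕ × ℕ)) (T : List (ℕ × Bool × Bool × ℕ)) : PIA Bool :=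
  codeToPIA (build F Sl T)

/-- Concrete view of a configuration. -/
def toT {n : ℕ} (c : PIAConfig (PA F Sl T) n) : TC n :=
  ⟨c.q, c.ρ (0 : Fin 2), c.ρ (1 : Fin 2), c.N⟩

/-- Configuration from concrete data. -/
def ofT {n : ℕ} (t : TC n) : PIAConfig (PA F Sl T) n := ⟨t.q, ![t.a, t.b], t.N⟩

theorem mem_build {q : ℕ} {k : Fin 2} {i j : Option (Fin 2)} {x : Bool} {q' : ℕ}
    (h : (q, (k : ℕ), endCode i, endCode j, x, q') ∈ T.map mvOf ++ startMoves) :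
    (∃ d, (q, d, x, q') ∈ T ∧ k = (if d then 1 else 0) ∧ i = some 0 ∧ j = some 1) ∨
    (q = 0 ∧ q' = 1 ∧ k = 0) ∨ (q = 1 ∧ q' = 2 ∧ k = 1 ∧ i = some 0) := by
  rcases List.mem_append.1 h with hm | hm
  · obtain ⟨⟨q, d, a, q'⟩, ht, he⟩ := List.mem_map.1 hm
    simp only [mvOf, Prod.mk.injEq] at he
    obtain ⟨rfl, e2, e3, e4, rfl, rfl⟩ := he
    refine Or.inl ⟨d, ht, ?_, endCode_one e3.symm, endCode_two e4.symm⟩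
    cases d
    · exact Fin.ext (by simpa using e2.symm)
    · exact Fin.ext (by simpa using e2.symm)
  · right
    simp only [startMoves, List.mem_cons, Prod.mk.injEq, List.not_mem_nil, or_false] at hm
    rcases hm with h | h | h | h
    · exact Or.inl ⟨h.1, h.2.2.2.2.2, Fin.ext h.2.1⟩
    · exact Or.inl ⟨h.1, h.2.2.2.2.2, Fin.ext h.2.1⟩
    · exact Or.inr ⟨h.1, h.2.2.2.2.2, Fin.ext h.2.1, endCode_one h.2.2.1⟩
    · exact Or.inr ⟨h.1, h.2.2.2.2.2, Fin.ext h.2.1, endCode_one h.2.2.1⟩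

theorem step_core {n : ℕ} {u : Fin n → Bool} {q q' : ℕ} {ρ ρ' : Fin 2 → Option (Fin n)}
    {N N' : Set (Fin n)} {k : Fin 2} {i j : Option (Fin 2)} {ℓ : Fin n}
    (hm : (q, (k : ℕ), endCode i, endCode j, u ℓ, q') ∈ T.map mvOf ++ startMoves)
    (hN : ℓ ∉ N) (hl : leftOK ρ i ℓ) (hr : rightOK ρ j ℓ)
    (hρ : ρ' = Function.update ρ k (some ℓ)) (hN' : N' = insert ℓ N) :
    St Sl T u ⟨q, ρ 0, ρ 1, N⟩ ⟨q', ρ' 0, ρ' 1, N'⟩ := by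
  subst hρ hN'
  rcases mem_build hm with ⟨d, ht, rfl, rfl, rfl⟩ | ⟨rfl, rfl, rfl⟩ | ⟨rfl, rfl, rfl, rfl⟩
  · obtain ⟨lo, h0, hl⟩ := hl
    obtain ⟨hi, h1, hr⟩ := hr
    rw [h0, h1]
    cases d
    · simpa [h1] using St.left ℓ ht hN hl hr
    · simpa [h0] using St.right ℓ ht hN hl hr
  · simpa using St.first ℓ hN
  · obtain ⟨lo, h0, hl⟩ := hl
    rw [h0]
    simpa [h0] using St.second ℓ hN hl

theorem step_toT {n : ℕ} {u : Fin n → Bool} {c c' : PIAConfig (PA F Sl T) n}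
    (h : PIAStep (PA F Sl T) u c c') : St Sl T u (toT c) (toT c') := by
  rcases h with ⟨h1, h2, h3⟩ | ⟨k, i, j, ℓ, hm, hN, hl, hr, hρ, hN'⟩
  · obtain ⟨q, ρ, N⟩ := c
    obtain ⟨q', ρ', N'⟩ := c'
    simp only at h1 h2 h3
    subst h2 h3
    exact St.silent h1
  · have hm' : ((show ℕ from c.q), (show ℕ from k.1), endCode i, endCode j, u ℓ,
        (show ℕ from c'.q)) ∈ T.map mvOf ++ startMoves := by
      cases i <;> cases j <;> exact hm
    exact step_core hm' hN hl hr hρ hN'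

theorem step_ofT {n : ℕ} {u : Fin n → Bool} {t t' : TC n}
    (h : St Sl T u t t') : PIAStep (PA F Sl T) u (ofT t) (ofT t') := by
  have up0 : ∀ x y z : Option (Fin n), ![z, y] = Function.update ![x, y] 0 z := by
    intro x y z; ext i : 1; fin_cases i <;> simp
  have up1 : ∀ x y z : Option (Fin n), ![x, z] = Function.update ![x, y] 1 z := by
    intro x y z; ext i : 1; fin_cases i <;> simp
  cases h with
  | silent h => exact Or.inl ⟨h, rfl, rfl⟩
  | left ℓ h hN hl hr =>
    refine Or.inr ⟨(0 : Fin 2), some (0 : Fin 2), some (1 : Fin 2), ℓ, ?_, hN, ⟨_, rfl, hl⟩,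
      ⟨_, rfl, hr⟩, up0 _ _ _, rfl⟩
    exact List.mem_append_left _ (List.mem_map.2 ⟨_, h, rfl⟩)
  | right ℓ h hN hl hr =>
    refine Or.inr ⟨(1 : Fin 2), some (0 : Fin 2), some (1 : Fin 2), ℓ, ?_, hN, ⟨_, rfl, hl⟩,
      ⟨_, rfl, hr⟩, up1 _ _ _, rfl⟩
    exact List.mem_append_left _ (List.mem_map.2 ⟨_, h, rfl⟩)
  | first ℓ hN =>
    refine Or.inr ⟨(0 : Fin 2), none, none, ℓ, ?_, hN, trivial, trivial, up0 _ _ _, rfl⟩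
    refine List.mem_append_right _ ?_
    change (0, 0, 0, 0, u ℓ, 1) ∈ startMoves
    cases u ℓ <;> simp [startMoves]
  | second ℓ hN hl =>
    refine Or.inr ⟨(1 : Fin 2), some (0 : Fin 2), none, ℓ, ?_, hN, ⟨_, rfl, hl⟩, trivial,
      up1 _ _ _, rfl⟩
    refine List.mem_append_right _ ?_
    change (1, 1, 1, 0, u ℓ, 2) ∈ startMoves
    cases u ℓ <;> simp [startMoves]

/-- Acceptance from a concrete configuration. -/
def AccT (F : List ℕ) (Sl : List (ℕ × ℕ)) (T : List (ℕ × Bool × Bool × ℕ)) {n : ℕ}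
    (u : Fin n → Bool) (t : TC n) : Prop :=
  ∃ t', Relation.ReflTransGen (St Sl T u) t t' ∧ (t'.q = 0 ∨ t'.q = 1 ∨ t'.q ∈ F) ∧
    t'.N = Set.univ

theorem accepts_iff (w : List Bool) :
    (PA F Sl T).Accepts w ↔ AccT F Sl T w.get ⟨0, none, none, ∅⟩ := by
  constructor
  · rintro ⟨c, hc, hF, hU⟩
    refine ⟨toT c, lift_rtg toT (fun _ _ => step_toT) hc, ?_, hU⟩
    have : (show ℕ from c.q) ∈ 0 :: 1 :: F := hF
    rw [List.mem_cons, List.mem_cons] at this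
    exact this
  · rintro ⟨t, ht, hF, hU⟩
    refine ⟨ofT t, ?_, ?_, hU⟩
    · have := lift_rtg (ofT (F := F) (Sl := Sl) (T := T))
        (fun _ _ => step_ofT) ht
      have e : PIAInit (PA F Sl T) w.length = ofT ⟨0, none, none, ∅⟩ := by
        unfold PIAInit ofT
        congr 1
        funext i
        change Fin 2 at i
        fin_cases i <;> rfl
      rw [e]; exact this
    · change t.q ∈ 0 :: 1 :: F
      rw [List.mem_cons, List.mem_cons]
      exact hF

/-- Well-formedness: only states at least two occur. -/
def WF (Sl : List (ℕ × ℕ)) (T : List (ℕ × Bool × Bool × ℕ)) : Prop :=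
  (∀ t ∈ Sl, 2 ≤ t.1 ∧ 2 ≤ t.2) ∧ (∀ t ∈ T, 2 ≤ t.1 ∧ 2 ≤ t.2.2.2)

/-- A position which is unread and no longer between the pebbles is never read. -/
theorem stuck (wf : WF Sl T) {n : ℕ} {u : Fin n → Bool} {c c' : TC n}
    (h : Relation.ReflTransGen (St Sl T u) c c') (x : Fin n) :
    ∀ lo hi, 2 ≤ c.q → c.a = some lo → c.b = some hi → (x ≤ lo ∨ hi ≤ x) →
      x ∉ c.N → x ∉ c'.N := by
  induction h using Relation.ReflTransGen.head_induction_on with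
  | refl => intro _ _ _ _ _ _ h; exact h
  | head hs _ ih =>
    intro lo hi hq h0 h1 hx hN
    cases hs with
    | silent h => exact ih lo hi (wf.1 _ h).2 h0 h1 hx hN
    | left ℓ h hℓ hl hr =>
      cases h0; cases h1
      have hne : x ≠ ℓ := by rintro rfl; rcases hx with hx | hx <;> omega
      exact ih ℓ hi (wf.2 _ h).2 rfl rfl (by omega) (by simp [hne]; exact hN)
    | right ℓ h hℓ hl hr =>
      cases h0; cases h1
      have hne : x ≠ ℓ := by rintro rfl; rcases hx with hx | hx <;> omega
      exact ih lo ℓ (wf.2 _ h).2 rfl rfl (by omega) (by simp [hne]; exact hN)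
    | first ℓ h => simp at hq
    | second ℓ h => simp at hq

theorem lin_complete {q : ℕ} {v : List Bool} (h : Lin F Sl T q v) (w : List Bool) :
    ∀ (p s : List Bool), w = p ++ v ++ s → ∀ (lo hi : Fin w.length), (lo : ℕ) + 1 = p.length →
    (hi : ℕ) = p.length + v.length → ∀ N : Set (Fin w.length), N = {x | x ≤ lo ∨ hi ≤ x} →
    AccT F Sl T w.get ⟨q, some lo, some hi, N⟩ := by
  induction h with
  | nil q hq =>
    intro p s hw lo hi hlo hhi N hN
    refine ⟨_, Relation.ReflTransGen.refl, Or.inr (Or.inr hq), ?_⟩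
    change N = _
    rw [hN]; ext x
    simp at hhi
    simp only [Set.mem_ofPred_eq, Set.mem_univ, iff_true]
    omega
  | silent q q' v hq _ ih =>
    intro p s hw lo hi hlo hhi N hN
    obtain ⟨c', hc, h⟩ := ih p s hw lo hi hlo hhi N hN
    exact ⟨c', Relation.ReflTransGen.head (St.silent hq) hc, h⟩
  | left q q' a v hq _ ih =>
    intro p s hw lo hi hlo hhi N hN
    simp only [List.length_cons] at hhi
    have hlt : p.length < w.length := by have := hi.2; omega
    let ℓ : Fin w.length := ⟨p.length, hlt⟩
    have ha : w.get ℓ = a := by simp [ℓ, hw]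
    obtain ⟨c', hc, h⟩ := ih (p ++ [a]) s (by simp [hw]) ℓ hi (by simp [ℓ]) (by simp; omega)
      (insert ℓ N) (by
        rw [hN]; ext x
        simp only [Set.mem_insert_iff, Set.mem_ofPred_eq, Fin.ext_iff, Fin.le_def, ℓ]
        omega)
    refine ⟨c', Relation.ReflTransGen.head (St.left ℓ (by rw [ha]; exact hq) ?_ ?_ ?_) hc, h⟩
    · rw [hN]; simp only [Set.mem_ofPred_eq, ℓ, Fin.le_def]; omega
    · rw [Fin.lt_def]; simp only [ℓ]; omega
    · rw [Fin.lt_def]; simp only [ℓ]; omega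
  | right q q' a v hq _ ih =>
    intro p s hw lo hi hlo hhi N hN
    simp only [List.length_append, List.length_singleton] at hhi
    have hlt : p.length + v.length < w.length := by have := hi.2; omega
    let ℓ : Fin w.length := ⟨p.length + v.length, hlt⟩
    have ha : w.get ℓ = a := by simp [ℓ, hw]
    obtain ⟨c', hc, h⟩ := ih p (a :: s) (by simp [hw]) lo ℓ hlo (by simp [ℓ])
      (insert ℓ N) (by
        rw [hN]; ext x
        simp only [Set.mem_insert_iff, Set.mem_ofPred_eq, Fin.ext_iff, Fin.le_def, ℓ]
        omega)
    refine ⟨c', Relation.ReflTransGen.head (St.right ℓ (by rw [ha]; exact hq) ?_ ?_ ?_) hc, h⟩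
    · rw [hN]; simp only [Set.mem_ofPred_eq, ℓ, Fin.le_def]; omega
    · rw [Fin.lt_def]; simp only [ℓ]; omega
    · rw [Fin.lt_def]; simp only [ℓ]; omega

theorem lin_sound (wf : WF Sl T) (w : List Bool) {c c' : TC w.length}
    (h : Relation.ReflTransGen (St Sl T w.get) c c') (hF : c'.q = 0 ∨ c'.q = 1 ∨ c'.q ∈ F)
    (hU : c'.N = Set.univ) :
    ∀ (p v s : List Bool), w = p ++ v ++ s → ∀ (lo hi : Fin w.length), (lo : ℕ) + 1 = p.length →
    (hi : ℕ) = p.length + v.length → c.a = some lo → c.b = some hi →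
    c.N = {x | x ≤ lo ∨ hi ≤ x} → 2 ≤ c.q → Lin F Sl T c.q v := by
  induction h using Relation.ReflTransGen.head_induction_on with
  | refl =>
    intro p v s hw lo hi hlo hhi h0 h1 hN hq
    have hv : v = [] := by
      by_contra hv
      have hv := List.length_pos_iff.2 hv
      have hlt : p.length < w.length := by have := hi.2; omega
      have : (⟨p.length, hlt⟩ : Fin w.length) ∈ c'.N := by rw [hU]; trivial
      rw [hN] at this
      simp only [Set.mem_ofPred_eq, Fin.le_def] at this
      omega
    subst hv
    refine Lin.nil _ ?_
    rcases hF with h | h | h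
    · omega
    · omega
    · exact h
  | head hs hrest ih =>
    intro p v s hw lo hi hlo hhi h0 h1 hN hq
    have st := stuck wf hrest
    rw [hU] at st
    cases hs with
    | silent h =>
      exact Lin.silent _ _ _ h (ih p v s hw lo hi hlo hhi h0 h1 hN (wf.1 _ h).2)
    | first ℓ h => simp at hq
    | second ℓ h => simp at hq
    | left ℓ ht hℓ hl hr =>
      cases h0; cases h1
      simp only at hN hq
      subst hN
      have hp : (ℓ : ℕ) = p.length := by
        by_contra hne
        have hlt : p.length < w.length := by have := hi.2; omega
        refine st ⟨p.length, hlt⟩ ℓ hi (wf.2 _ ht).2 rfl rfl ?_ ?_ trivial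
        · left; rw [Fin.le_def]; simp only; omega
        · simp only [Set.mem_insert_iff, Set.mem_ofPred_eq, Fin.ext_iff, Fin.le_def]
          omega
      rcases v with _ | ⟨a, v⟩
      · simp at hhi; omega
      · have ha : w.get ℓ = a := by
          simp [hp, hw]
        rw [ha] at ht
        refine Lin.left _ _ _ _ ht (ih (p ++ [a]) v s (by simp [hw]) ℓ hi (by simp [hp])
          (by simp at hhi ⊢; omega) rfl rfl ?_ (wf.2 _ ht).2)
        ext x
        simp only [Set.mem_insert_iff, Set.mem_ofPred_eq, Fin.ext_iff, Fin.le_def]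
        omega
    | right ℓ ht hℓ hl hr =>
      cases h0; cases h1
      simp only at hN hq
      subst hN
      have hp : (ℓ : ℕ) + 1 = hi := by
        by_contra hne
        have hlt : (hi : ℕ) - 1 < w.length := by have := hi.2; omega
        refine st ⟨hi - 1, hlt⟩ lo ℓ (wf.2 _ ht).2 rfl rfl ?_ ?_ trivial
        · right; rw [Fin.le_def]; simp only; omega
        · simp only [Set.mem_insert_iff, Set.mem_ofPred_eq, Fin.ext_iff, Fin.le_def]
          omega
      rcases List.eq_nil_or_concat v with rfl | ⟨v, a, rfl⟩
      · simp at hhi; omega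
      · simp at hhi
        have ha : w.get ℓ = a := by
          have : (ℓ : ℕ) = p.length + v.length := by omega
          simp [this, hw]
        rw [ha] at ht
        try rw [List.concat_eq_append]
        refine Lin.right _ _ _ _ ht (ih p v (a :: s) (by simp [hw]) lo ℓ hlo
          (by omega) rfl rfl ?_ (wf.2 _ ht).2)
        ext x
        simp only [Set.mem_insert_iff, Set.mem_ofPred_eq, Fin.ext_iff, Fin.le_def]
        omega

theorem step_inv0 (wf : WF Sl T) {n : ℕ} {u : Fin n → Bool} {c' : TC n}
    {a b : Option (Fin n)} {N : Set (Fin n)} (h : St Sl T u ⟨0, a, b, N⟩ c') :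
    ∃ ℓ : Fin n, c' = ⟨1, some ℓ, b, insert ℓ N⟩ := by
  cases h with
  | silent h => simpa using (wf.1 _ h).1
  | left ℓ h => simpa using (wf.2 _ h).1
  | right ℓ h => simpa using (wf.2 _ h).1
  | first ℓ h => exact ⟨ℓ, rfl⟩

theorem step_inv1 (wf : WF Sl T) {n : ℕ} {u : Fin n → Bool} {c' : TC n}
    {lo : Fin n} {b : Option (Fin n)} {N : Set (Fin n)} (h : St Sl T u ⟨1, some lo, b, N⟩ c') :
    ∃ ℓ : Fin n, lo < ℓ ∧ c' = ⟨2, some lo, some ℓ, insert ℓ N⟩ := by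
  cases h with
  | silent h => simpa using (wf.1 _ h).1
  | left ℓ h => simpa using (wf.2 _ h).1
  | right ℓ h => simpa using (wf.2 _ h).1
  | second ℓ h hl => exact ⟨ℓ, hl, rfl⟩

theorem accepts_lin (wf : WF Sl T) (a b : Bool) (v : List Bool)
    (h : (PA F Sl T).Accepts (a :: v ++ [b])) : Lin F Sl T 2 v := by
  generalize hw : a :: v ++ [b] = w at h
  have hlen : w.length = v.length + 2 := by simp [← hw]
  rw [accepts_iff] at h
  obtain ⟨c, hc, hF, hU⟩ := h
  let x0 : Fin w.length := ⟨0, by omega⟩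
  let x1 : Fin w.length := ⟨v.length + 1, by omega⟩
  have hx : x0 ≠ x1 := by simp [x0, x1, Fin.ext_iff]
  rcases Relation.ReflTransGen.cases_head hc with rfl | ⟨c1, hs1, hc1⟩
  · simp only at hU
    have : x0 ∈ (∅ : Set (Fin w.length)) := by rw [hU]; trivial
    exact absurd this (by simp)
  obtain ⟨lo, rfl⟩ := step_inv0 wf hs1
  rcases Relation.ReflTransGen.cases_head hc1 with rfl | ⟨c2, hs2, hc2⟩
  · simp only [insert_empty_eq] at hU
    have m0 : x0 ∈ ({lo} : Set (Fin w.length)) := by rw [hU]; trivial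
    have m1 : x1 ∈ ({lo} : Set (Fin w.length)) := by rw [hU]; trivial
    simp at m0 m1
    exact absurd (m0.trans m1.symm) hx
  obtain ⟨ℓ1, hl, rfl⟩ := step_inv1 wf hs2
  have st := stuck wf hc2
  rw [hU] at st
  have z0 : lo = x0 := by
    by_contra hne
    refine st x0 lo ℓ1 le_rfl rfl rfl (Or.inl ?_) ?_ trivial
    · simp [Fin.le_def, x0]
    · simp only [Set.mem_insert_iff, Set.mem_empty_iff_false, or_false, not_or]
      refine ⟨?_, fun h => hne h.symm⟩
      rintro rfl
      simp [Fin.lt_def, x0] at hl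
  have z1 : ℓ1 = x1 := by
    by_contra hne
    refine st x1 lo ℓ1 le_rfl rfl rfl (Or.inr ?_) ?_ trivial
    · have := ℓ1.2
      rw [Fin.le_def]; simp only [x1]; omega
    · simp only [Set.mem_insert_iff, Set.mem_empty_iff_false, or_false, not_or]
      refine ⟨fun h => hne h.symm, ?_⟩
      rw [z0]; exact hx.symm
  exact lin_sound wf w hc2 hF hU [a] v [b] (by simp [← hw]) lo ℓ1 (by simp [z0, x0])
    (by simp [z1, x1]; omega) rfl rfl (by
      rw [z0, z1]; ext x
      have := x.2
      simp only [Set.mem_insert_iff, Set.mem_empty_iff_false, or_false, Set.mem_ofPred_eq,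
        Fin.ext_iff, Fin.le_def, x0, x1]
      omega) le_rfl

theorem pia_iff (wf : WF Sl T) :
    (∀ w, (PA F Sl T).Accepts w) ↔ ∀ v, Lin F Sl T 2 v := by
  constructor
  · intro h v
    exact accepts_lin wf true true v (h _)
  · intro h w
    rw [accepts_iff]
    rcases w with _ | ⟨a, w⟩
    · refine ⟨_, Relation.ReflTransGen.refl, Or.inl rfl, ?_⟩
      ext x; exact x.elim0
    rcases List.eq_nil_or_concat w with rfl | ⟨v, b, rfl⟩
    · refine ⟨_, Relation.ReflTransGen.single (St.first (0 : Fin 1) (by simp)),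
        Or.inr (Or.inl rfl), ?_⟩
      change insert _ _ = _
      ext x
      simpa using Subsingleton.elim (α := Fin 1) _ _
    · try rw [List.concat_eq_append]
      generalize hw : a :: (v ++ [b]) = w
      have hlen : w.length = v.length + 2 := by simp [← hw]
      let x0 : Fin w.length := ⟨0, by omega⟩
      let x1 : Fin w.length := ⟨v.length + 1, by omega⟩
      have hx : x0 ≠ x1 := by simp [x0, x1, Fin.ext_iff]
      obtain ⟨c', hc, h⟩ := lin_complete (h v) w [a] [b] (by simp [← hw]) x0 x1 (by simp [x0])
        (by simp [x1]; omega) (insert x1 (insert x0 ∅)) (by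
          ext x
          have := x.2
          simp only [Set.mem_insert_iff, Set.mem_empty_iff_false, or_false, Set.mem_ofPred_eq,
            Fin.ext_iff, Fin.le_def, x0, x1]
          omega)
      refine ⟨c', ?_, h⟩
      refine Relation.ReflTransGen.head (St.first x0 (by simp)) ?_
      refine Relation.ReflTransGen.head (St.second x1 ?_ ?_) hc
      · simpa using hx.symm
      · simp [x0, x1, Fin.lt_def]

end pia

open Turing StateTransition in
/-- Configurations of the small-step machine. -/
abbrev QCfg : Type :=
  PartrecToTM2.Stmt' × Option PartrecToTM2.Γ' × List (PartrecToTM2.K' × PartrecToTM2.Γ')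

/-- Project the tagged list to one stack. -/
def stkOf (k : Turing.PartrecToTM2.K')
    (u : List (Turing.PartrecToTM2.K' × Turing.PartrecToTM2.Γ')) :
    List Turing.PartrecToTM2.Γ' := (u.filter (fun x => x.1 = k)).map (fun x => x.2)

open Turing in
/-- Small steps. -/
def sm : QCfg → Option QCfg
  | (TM2.Stmt.push k f q, v, u) => some (q, v, (k, f v) :: u)
  | (TM2.Stmt.peek k f q, v, u) => some (q, f v (stkOf k u).head?, u)
  | (TM2.Stmt.pop k f q, v, u) =>
      some (q, f v (stkOf k u).head?, u.eraseP (fun x => x.1 = k))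
  | (TM2.Stmt.load f q, v, u) => some (q, f v, u)
  | (TM2.Stmt.branch f q₁ q₂, v, u) => some (cond (f v) q₁ q₂, v, u)
  | (TM2.Stmt.goto l, v, u) => some (PartrecToTM2.tr (l v), v, u)
  | (TM2.Stmt.halt, _, _) => none

section
open Turing StateTransition PartrecToTM2

theorem stkOf_cons_self (k : K') (g : Γ') (u : List (K' × Γ')) :
    stkOf k ((k, g) :: u) = g :: stkOf k u := by simp [stkOf]

theorem stkOf_cons_ne {k k' : K'} (h : k ≠ k') (g : Γ') (u : List (K' × Γ')) :
    stkOf k ((k', g) :: u) = stkOf k u := by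
  have : ¬ k' = k := fun e => h e.symm
  simp [stkOf, this]

theorem stkOf_eraseP_self (k : K') (u : List (K' × Γ')) :
    stkOf k (u.eraseP (fun x => x.1 = k)) = (stkOf k u).tail := by
  induction u with
  | nil => simp [stkOf]
  | cons a u ih =>
    obtain ⟨k', g⟩ := a
    by_cases h : k' = k
    · subst h
      simp [stkOf_cons_self]
    · rw [List.eraseP_cons_of_neg (by simpa using h), stkOf_cons_ne (Ne.symm h), ih,
        stkOf_cons_ne (Ne.symm h)]

theorem stkOf_eraseP_ne {k k' : K'} (h : k ≠ k') (u : List (K' × Γ')) :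
    stkOf k (u.eraseP (fun x => x.1 = k')) = stkOf k u := by
  induction u with
  | nil => simp [stkOf]
  | cons a u ih =>
    obtain ⟨k'', g⟩ := a
    by_cases h2 : k'' = k'
    · subst h2
      simp [stkOf_cons_ne h]
    · rw [List.eraseP_cons_of_neg (by simpa using h2)]
      by_cases h3 : k = k''
      · subst h3
        rw [stkOf_cons_self, stkOf_cons_self, ih]
      · rw [stkOf_cons_ne h3, stkOf_cons_ne h3, ih]

/-- The statement of an optional label. -/
def stmtOf : Option Λ' → Stmt'
  | none => TM2.Stmt.halt
  | some l => tr l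

/-- Simulation relation. -/
def TRel (c : TM2.Cfg (fun _ : K' => Γ') Λ' (Option Γ')) (b : QCfg) : Prop :=
  b.1 = stmtOf c.l ∧ b.2.1 = c.var ∧ ∀ k, c.stk k = stkOf k b.2.2

theorem reach_aux (q : Stmt') : ∀ (v : Option Γ') (u : List (K' × Γ')) (S : K' → List Γ'),
    (∀ k, S k = stkOf k u) →
    ∃ b, Reaches sm (q, v, u) b ∧ TRel (TM2.stepAux q v S) b ∧
      (q ≠ TM2.Stmt.halt → Reaches₁ sm (q, v, u) b) := by
  have key : ∀ (a a' : QCfg) c, sm a = some a' → (∃ b, Reaches sm a' b ∧ TRel c b ∧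
      (a'.1 ≠ TM2.Stmt.halt → Reaches₁ sm a' b)) →
      ∃ b, Reaches sm a b ∧ TRel c b ∧ (a.1 ≠ TM2.Stmt.halt → Reaches₁ sm a b) := by
    rintro a a' c h ⟨b, h1, h2, -⟩
    have : Reaches₁ sm a b := Relation.TransGen.head' (by simpa using h) h1
    exact ⟨b, this.to_reflTransGen, h2, fun _ => this⟩
  induction q with
  | push k f q ih =>
    intro v u S hS
    refine key _ (q, v, (k, f v) :: u) _ rfl (ih v _ _ ?_)
    intro k'
    by_cases h : k' = k
    · subst h; simp [stkOf_cons_self, hS]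
    · rw [Function.update_of_ne h, stkOf_cons_ne h, hS]
  | peek k f q ih =>
    intro v u S hS
    refine key _ (q, f v (stkOf k u).head?, u) _ rfl ?_
    simp only [TM2.stepAux, hS k]
    exact ih _ _ _ hS
  | pop k f q ih =>
    intro v u S hS
    refine key _ (q, f v (stkOf k u).head?, u.eraseP (fun x => x.1 = k)) _ rfl ?_
    simp only [TM2.stepAux, hS k]
    refine ih _ _ _ ?_
    intro k'
    by_cases h : k' = k
    · subst h; simp [stkOf_eraseP_self]
    · rw [Function.update_of_ne h, stkOf_eraseP_ne h, hS]
  | load f q ih =>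
    intro v u S hS
    exact key _ (q, f v, u) _ rfl (ih _ _ _ hS)
  | branch f q₁ q₂ ih₁ ih₂ =>
    intro v u S hS
    refine key _ (cond (f v) q₁ q₂, v, u) _ rfl ?_
    simp only [TM2.stepAux]
    cases f v
    · exact ih₂ _ _ _ hS
    · exact ih₁ _ _ _ hS
  | goto l =>
    intro v u S hS
    have h : Reaches₁ sm ((TM2.Stmt.goto l : Stmt'), v, u) (tr (l v), v, u) :=
      Relation.TransGen.single rfl
    exact ⟨_, h.to_reflTransGen, ⟨rfl, rfl, hS⟩, fun _ => h⟩
  | halt =>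
    intro v u S hS
    exact ⟨_, Relation.ReflTransGen.refl, ⟨rfl, rfl, hS⟩, fun h => absurd rfl h⟩

theorem tr_ne_halt (l : Λ') : tr l ≠ TM2.Stmt.halt := by
  rcases l with _ | _ | _ | _ | _ | _ | _ | k
  all_goals first
    | (rcases k with _ | _ | _ | _ | _ <;> intro h <;> cases h)
    | (intro h; cases h)

theorem respects_sm : Respects (TM2.step tr) sm TRel := by
  rintro ⟨l, v, S⟩ ⟨q, v', u⟩ ⟨h1, h2, h3⟩
  dsimp only at h1 h2 h3
  subst h1 h2
  cases l with
  | none => exact rfl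
  | some l =>
    obtain ⟨b, -, hb, hr⟩ := reach_aux (tr l) v' u S h3
    exact ⟨b, hb, hr (tr_ne_halt l)⟩

/-- Initial tagged stack. -/
def initU (w : List Γ') : List (K' × Γ') := w.map fun g => (K'.main, g)

theorem sm_dom (c : ToPartrec.Code) (v : List ℕ) :
    (ToPartrec.Code.eval c v).Dom ↔
      (eval sm (tr (trNormal c Cont'.halt), none, initU (trList v))).Dom := by
  have hrel : TRel (init c v) (tr (trNormal c Cont'.halt), none, initU (trList v)) := by
    refine ⟨rfl, rfl, ?_⟩
    intro k
    have hh : ∀ w : List Γ', stkOf K'.main (initU w) = w := by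
      intro w; simp [stkOf, initU, List.filter_map, Function.comp_def]
    have hn : ∀ w : List Γ', ∀ k, k ≠ K'.main → stkOf k (initU w) = [] := by
      intro w k hk
      simp [stkOf, initU, hk.symm]
    cases k
    · exact (hh _).symm
    all_goals exact (hn _ _ (by decide)).symm
  rw [tr_eval_dom respects_sm hrel, PartrecToTM2.tr_eval]
  simp
end

section transducer
variable {C Γ : Type} (δ : C → Γ → C × List Γ)

/-- Final state of a transducer. -/
def ost : C → List Γ → C
  | q, [] => q
  | q, a :: x => ost (δ q a).1 x

/-- Output of a transducer. -/
def out : C → List Γ → List Γ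
  | _, [] => []
  | q, a :: x => (δ q a).2 ++ out (δ q a).1 x

theorem ost_append (q : C) (x y : List Γ) : ost δ q (x ++ y) = ost δ (ost δ q x) y := by
  induction x generalizing q with
  | nil => rfl
  | cons a x ih => simp [ost, ih]

theorem out_append (q : C) (x y : List Γ) :
    out δ q (x ++ y) = out δ q x ++ out δ (ost δ q x) y := by
  induction x generalizing q with
  | nil => rfl
  | cons a x ih => simp [ost, out, ih]

theorem ost_sink {sink : C} (h : ∀ a, (δ sink a).1 = sink) (x : List Γ) : ost δ sink x = sink := by
  induction x with
  | nil => rfl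
  | cons a x ih => simp [ost, h, ih]

theorem hist_iff {X : Type} (step : X → Option X) (ctl : X → C) (block : X → List Γ) (sink : C)
    (hne : ∀ a, block a ≠ [])
    (hstep : ∀ a b, step a = some b →
      ost δ (ctl a) (block a) = ctl b ∧ out δ (ctl a) (block a) = block b)
    (hhalt : ∀ a, step a = none →
      ost δ (ctl a) (block a) = sink ∧ ∃ g, out δ (ctl a) (block a) = [g])
    (habs : ∀ a, (δ sink a).1 = sink) (hctl : ∀ a, ctl a ≠ sink) (a₀ : X) :
    (∃ x b, ost δ (ctl a₀) (block a₀ ++ x) = sink ∧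
      (x ++ [b]) <+: out δ (ctl a₀) (block a₀ ++ x)) ↔
    (StateTransition.eval step a₀).Dom := by
  constructor
  · rintro ⟨x, b, h1, h2⟩
    by_contra hd
    have hnon : ∀ c, StateTransition.Reaches step a₀ c → ∃ d, step c = some d := by
      intro c hc
      rcases hs : step c with _ | d
      · exact absurd (Part.dom_iff_mem.2 ⟨c, StateTransition.mem_eval.2 ⟨hc, hs⟩⟩) hd
      · exact ⟨d, rfl⟩
    choose! nx hnx using hnon
    let sq : ℕ → X := fun n => nx^[n] a₀
    have hsq : ∀ n, sq (n + 1) = nx (sq n) := fun n => Function.iterate_succ_apply' nx n a₀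
    have hreach : ∀ n, StateTransition.Reaches step a₀ (sq n) := by
      intro n
      induction n with
      | zero => exact Relation.ReflTransGen.refl
      | succ n ih =>
        refine ih.tail ?_
        rw [hsq]
        exact hnx _ ih
    have hst : ∀ n, step (sq n) = some (sq (n + 1)) := fun n => by rw [hsq]; exact hnx _ (hreach n)
    let H : ℕ → List Γ := fun n => Nat.rec (block a₀) (fun n l => l ++ block (sq (n + 1))) n
    have H0 : H 0 = block a₀ := rfl
    have HS : ∀ n, H (n + 1) = H n ++ block (sq (n + 1)) := fun n => rfl
    have hH : ∀ n, ost δ (ctl a₀) (H n) = ctl (sq (n + 1)) ∧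
        block a₀ ++ out δ (ctl a₀) (H n) = H (n + 1) := by
      intro n
      induction n with
      | zero =>
        have := hstep _ _ (hst 0)
        refine ⟨this.1, ?_⟩
        rw [HS, H0]
        exact congrArg _ this.2
      | succ n ih =>
        have := hstep _ _ (hst (n + 1))
        rw [HS n, ost_append, out_append, ih.1, this.1, this.2, ← List.append_assoc, ih.2]
        exact ⟨rfl, (HS (n + 1)).symm⟩
    have hlen : ∀ n, n < (H n).length := by
      intro n
      induction n with
      | zero => rw [H0]; exact List.length_pos_iff.2 (hne _)
      | succ n ih =>
        rw [HS, List.length_append]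
        have := List.length_pos_iff.2 (hne (sq (n + 1)))
        omega
    have hcmp : ∀ n, (block a₀ ++ x) <+: H n ∨ H n <+: (block a₀ ++ x) := by
      intro n
      induction n with
      | zero => exact Or.inr (List.prefix_append _ _)
      | succ n ih =>
        rcases ih with ih | ih
        · exact Or.inl (ih.trans (by rw [HS]; exact List.prefix_append _ _))
        · rw [← (hH n).2, List.prefix_append_right_inj, List.prefix_append_right_inj]
          refine List.prefix_or_prefix_of_prefix ((List.prefix_append _ _).trans h2) ?_
          obtain ⟨t, ht⟩ := ih
          rw [← ht, out_append]
          exact List.prefix_append _ _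
    have hfin : (block a₀ ++ x) <+: H (block a₀ ++ x).length := by
      rcases hcmp (block a₀ ++ x).length with h | h
      · exact h
      · exact absurd (hlen (block a₀ ++ x).length) (not_lt.2 h.length_le)
    obtain ⟨t, ht⟩ := hfin
    have := (hH (block a₀ ++ x).length).1
    rw [← ht, ost_append, h1, ost_sink δ habs] at this
    exact hctl _ this.symm
  · intro hd
    obtain ⟨c, hc⟩ := Part.dom_iff_mem.1 hd
    obtain ⟨hr, hn⟩ := StateTransition.mem_eval.1 hc
    suffices ∃ x b, ost δ (ctl a₀) (block a₀ ++ x) = sink ∧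
        out δ (ctl a₀) (block a₀ ++ x) = x ++ [b] by
      obtain ⟨x, b, h1, h2⟩ := this
      exact ⟨x, b, h1, by rw [h2]⟩
    clear hd hc
    induction hr using Relation.ReflTransGen.head_induction_on with
    | refl =>
      obtain ⟨h1, g, h2⟩ := hhalt c hn
      exact ⟨[], g, by simpa using h1, by simpa using h2⟩
    | head h _ ih =>
      rename_i a a' _
      obtain ⟨y, b, h1, h2⟩ := ih
      have h3 := hstep a a' h
      refine ⟨block a' ++ y, b, ?_, ?_⟩
      · rw [ost_append, h3.1, h1]
      · rw [out_append, h3.1, h2, h3.2, List.append_assoc]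
end transducer

section machine
open Turing StateTransition PartrecToTM2

/-- Control states of the transducer. -/
inductive Ctl
  | fresh (q : Stmt') (v : Option Γ')
  | copy (q : Stmt') (v : Option Γ')
  | sink

/-- Letters: tagged stack symbols and the block end marker. -/
abbrev Ltr := Option (K' × Γ')

/-- Copying state. -/
def cp (q : Stmt') (v : Option Γ') : Ltr → Ctl
  | none => .fresh q v
  | some _ => .copy q v

/-- The transducer performing one small step per block. -/
def del : Ctl → Ltr → Ctl × List Ltr
  | .fresh (TM2.Stmt.push k f q) v, a => (cp q v a, [some (k, f v), a])
  | .fresh (TM2.Stmt.peek _ f q) v, none => (.fresh q (f v none), [none])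
  | .fresh (TM2.Stmt.peek k f q) v, some (k', g) =>
      if k' = k then (.copy q (f v (some g)), [some (k', g)])
      else (.fresh (TM2.Stmt.peek k f q) v, [some (k', g)])
  | .fresh (TM2.Stmt.pop _ f q) v, none => (.fresh q (f v none), [none])
  | .fresh (TM2.Stmt.pop k f q) v, some (k', g) =>
      if k' = k then (.copy q (f v (some g)), [])
      else (.fresh (TM2.Stmt.pop k f q) v, [some (k', g)])
  | .fresh (TM2.Stmt.load f q) v, a => (cp q (f v) a, [a])
  | .fresh (TM2.Stmt.branch f q₁ q₂) v, a => (cp (cond (f v) q₁ q₂) v a, [a])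
  | .fresh (TM2.Stmt.goto l) v, a => (cp (tr (l v)) v a, [a])
  | .fresh TM2.Stmt.halt _, a => (.sink, [a])
  | .copy q v, a => (cp q v a, [a])
  | .sink, _ => (.sink, [])

/-- The block of a tagged stack. -/
def blk (u : List (K' × Γ')) : List Ltr := u.map some ++ [none]

theorem copy_blk (q : Stmt') (v : Option Γ') (u : List (K' × Γ')) :
    ost del (.copy q v) (blk u) = .fresh q v ∧ out del (.copy q v) (blk u) = blk u := by
  induction u with
  | nil => simp [blk, ost, out, del, cp]
  | cons a u ih =>
    have : blk (a :: u) = some a :: blk u := rfl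
    rw [this]
    simp [ost, out, del, cp, ih]

theorem cp_blk (c : Ctl) (q : Stmt') (v : Option Γ') (h : ∀ a, del c a = (cp q v a, [a]))
    (u : List (K' × Γ')) :
    ost del c (blk u) = .fresh q v ∧ out del c (blk u) = blk u := by
  cases u with
  | nil => simp [blk, ost, out, h, cp]
  | cons a u =>
    have : blk (a :: u) = some a :: blk u := rfl
    rw [this]
    simp [ost, out, h, cp, copy_blk]

theorem del_step (q : Stmt') (v : Option Γ') (u : List (K' × Γ')) (q' : Stmt') (v' : Option Γ')
    (u' : List (K' × Γ')) (h : sm (q, v, u) = some (q', v', u')) :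
    ost del (.fresh q v) (blk u) = .fresh q' v' ∧ out del (.fresh q v) (blk u) = blk u' := by
  cases q with
  | push k f q =>
    simp only [sm, Option.some.injEq, Prod.mk.injEq] at h
    obtain ⟨rfl, rfl, rfl⟩ := h
    cases u with
    | nil => simp [blk, ost, out, del, cp]
    | cons a u =>
      have : ∀ a u, blk (a :: u) = some a :: blk u := fun _ _ => rfl
      rw [this, this, this]
      simp [ost, out, del, cp, copy_blk]
  | peek k f q =>
    simp only [sm, Option.some.injEq, Prod.mk.injEq] at h
    obtain ⟨rfl, rfl, rfl⟩ := h
    induction u with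
    | nil => simp [blk, ost, out, del, stkOf]
    | cons a u ih =>
      have : blk (a :: u) = some a :: blk u := rfl
      rw [this]
      obtain ⟨k', g⟩ := a
      by_cases hk : k' = k
      · subst hk
        simp [ost, out, del, copy_blk, stkOf_cons_self]
      · simp only [ost, out, del, hk, if_false, stkOf_cons_ne (Ne.symm hk), ih]
        simp
  | pop k f q =>
    simp only [sm, Option.some.injEq, Prod.mk.injEq] at h
    obtain ⟨rfl, rfl, rfl⟩ := h
    induction u with
    | nil => simp [blk, ost, out, del, stkOf]
    | cons a u ih =>
      have : ∀ a u, blk (a :: u) = some a :: blk u := fun _ _ => rfl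
      rw [this]
      obtain ⟨k', g⟩ := a
      by_cases hk : k' = k
      · subst hk
        simp [ost, out, del, copy_blk, stkOf_cons_self]
      · rw [List.eraseP_cons_of_neg (by simpa using hk), this]
        simp only [ost, out, del, hk, if_false, stkOf_cons_ne (Ne.symm hk), ih]
        simp
  | load f q =>
    simp only [sm, Option.some.injEq, Prod.mk.injEq] at h
    obtain ⟨rfl, rfl, rfl⟩ := h
    exact cp_blk _ _ _ (fun a => rfl) u
  | branch f q₁ q₂ =>
    simp only [sm, Option.some.injEq, Prod.mk.injEq] at h
    obtain ⟨rfl, rfl, rfl⟩ := h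
    exact cp_blk _ _ _ (fun a => rfl) u
  | goto l =>
    simp only [sm, Option.some.injEq, Prod.mk.injEq] at h
    obtain ⟨rfl, rfl, rfl⟩ := h
    exact cp_blk _ _ _ (fun a => rfl) u
  | halt => simp [sm] at h

theorem out_sink (x : List Ltr) : out del .sink x = [] := by
  induction x with
  | nil => rfl
  | cons a x ih => simp [out, del, ih]

theorem del_halt (q : Stmt') (v : Option Γ') (u : List (K' × Γ')) (h : sm (q, v, u) = none) :
    ost del (.fresh q v) (blk u) = .sink ∧ ∃ g, out del (.fresh q v) (blk u) = [g] := by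
  cases q with
  | halt =>
    have : ∃ a x, blk u = a :: x := by
      cases u with
      | nil => exact ⟨_, _, rfl⟩
      | cons a u => exact ⟨_, _, rfl⟩
    obtain ⟨a, x, hx⟩ := this
    rw [hx]
    exact ⟨ost_sink del (fun _ => rfl) x, a, by simp [out, del, out_sink]⟩
  | _ => simp [sm] at h

/-- Initial control state. -/
def q0 (c : ToPartrec.Code) : Ctl := .fresh (tr (trNormal c Cont'.halt)) none

/-- Initial block. -/
def ini (n : ℕ) : List Ltr := blk (initU (trList [n]))

theorem hist (c : ToPartrec.Code) (n : ℕ) :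
    (∃ x b, ost del (q0 c) (ini n ++ x) = .sink ∧ (x ++ [b]) <+: out del (q0 c) (ini n ++ x)) ↔
      (ToPartrec.Code.eval c [n]).Dom := by
  rw [sm_dom]
  exact hist_iff del sm (fun a => .fresh a.1 a.2.1) (fun a => blk a.2.2) .sink
    (fun a => by simp [blk]) (fun a b h => del_step _ _ _ _ _ _ h)
    (fun a h => del_halt _ _ _ h) (fun _ => rfl) (fun a => by simp)
    (tr (trNormal c Cont'.halt), none, initU (trList [n]))
end machine

section checker
variable {S : Type}

/-- Acceptance of a deterministic two-sided checker. -/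
inductive Acc2 (dir : S → Bool) (next : S → Bool → S) (acc : S → Prop) : S → List Bool → Prop
  | nil (s : S) : acc s → Acc2 dir next acc s []
  | left (s : S) (a : Bool) (v : List Bool) : dir s = false → Acc2 dir next acc (next s a) v →
      Acc2 dir next acc s (a :: v)
  | right (s : S) (a : Bool) (v : List Bool) : dir s = true → Acc2 dir next acc (next s a) v →
      Acc2 dir next acc s (v ++ [a])

variable {dir : S → Bool} {next : S → Bool → S} {acc : S → Prop}

theorem acc2_nil (s : S) : Acc2 dir next acc s [] ↔ acc s := by
  constructor
  · intro h
    generalize hw : ([] : List Bool) = w at h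
    cases h with
    | nil _ h => exact h
    | left => simp at hw
    | right => simp at hw
  · exact Acc2.nil s

theorem acc2_left {s : S} (hs : dir s = false) (a : Bool) (v : List Bool) :
    Acc2 dir next acc s (a :: v) ↔ Acc2 dir next acc (next s a) v := by
  constructor
  · intro h
    generalize hw : a :: v = w at h
    cases h with
    | nil _ h => simp at hw
    | left _ a' v' _ h =>
      simp only [List.cons.injEq] at hw
      obtain ⟨rfl, rfl⟩ := hw
      exact h
    | right _ _ _ h => simp [hs] at h
  · exact Acc2.left s a v hs

theorem acc2_right {s : S} (hs : dir s = true) (a : Bool) (v : List Bool) :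
    Acc2 dir next acc s (v ++ [a]) ↔ Acc2 dir next acc (next s a) v := by
  constructor
  · intro h
    generalize hw : v ++ [a] = w at h
    cases h with
    | nil _ h => simp at hw
    | left _ a' v' h => simp [hs] at h
    | right _ _ _ _ h =>
      obtain ⟨rfl, h2⟩ := List.append_inj' hw rfl
      simp only [List.cons.injEq, and_true] at h2
      subst h2
      exact h
  · exact Acc2.right s a v hs

/-- Accepting states of the grammar. -/
def gF (F0 : List ℕ) (β : List Bool) : List ℕ :=
  F0 ++ (List.range β.length).map (fun i => 2 * i + 4)

/-- Silent transitions of the grammar. -/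
def gS (e1 e2 : ℕ) (β : List Bool) : List (ℕ × ℕ) :=
  [(2, e1), (2, 4), (2 * β.length + 4, e2)]

/-- Transitions of the grammar. -/
def gT (T0 : List (ℕ × Bool × Bool × ℕ)) (ea : ℕ) (β : List Bool) :
    List (ℕ × Bool × Bool × ℕ) :=
  T0 ++ ((List.range β.length).map (fun i => (2 * i + 4, false, β.getD i false, 2 * i + 6)) ++
    (List.range β.length).map (fun i => (2 * i + 4, false, !(β.getD i false), ea)))

theorem checker_lin (R : Set S) (hR : R.Finite) (hcl : ∀ s ∈ R, ∀ b, next s b ∈ R)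
    (s1 s2 sa : S) (h1 : s1 ∈ R) (h2 : s2 ∈ R) (ha : sa ∈ R)
    (hacc : ∀ w, Acc2 dir next acc sa w) :
    ∃ (F0 : List ℕ) (T0 : List (ℕ × Bool × Bool × ℕ)) (e1 e2 ea : ℕ), ∀ β : List Bool,
      WF (gS e1 e2 β) (gT T0 ea β) ∧
      ∀ w, Lin (gF F0 β) (gS e1 e2 β) (gT T0 ea β) 2 w ↔
        Acc2 dir next acc s1 w ∨ ∀ v, w = β ++ v → Acc2 dir next acc s2 v := by
  classical
  obtain ⟨e, he⟩ := Set.countable_iff_exists_injOn.1 hR.countable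
  let E : S → ℕ := fun s => 2 * e s + 3
  have hE : ∀ s ∈ R, ∀ s' ∈ R, E s = E s' → s = s' := by
    intro s hs s' hs' h
    exact he hs hs' (by simp only [E] at h; omega)
  let F0 : List ℕ := ((hR.toFinset.filter acc).image E).toList
  let T0 : List (ℕ × Bool × Bool × ℕ) :=
    ((hR.toFinset ×ˢ (Finset.univ : Finset Bool)).image
      (fun p => (E p.1, dir p.1, p.2, E (next p.1 p.2)))).toList
  have mF0 : ∀ n, n ∈ F0 ↔ ∃ s ∈ R, acc s ∧ E s = n := by
    intro n; simp [F0, and_assoc]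
  have mT0 : ∀ t, t ∈ T0 ↔ ∃ s ∈ R, ∃ b, (E s, dir s, b, E (next s b)) = t := by
    intro t
    simp only [T0, Finset.mem_toList, Finset.mem_image, Finset.mem_product, Set.Finite.mem_toFinset,
      Finset.mem_univ, and_true, Prod.exists]
    constructor
    · rintro ⟨s, b, hs, h⟩; exact ⟨s, hs, b, h⟩
    · rintro ⟨s, hs, b, h⟩; exact ⟨s, b, hs, h⟩
  refine ⟨F0, T0, E s1, E s2, E sa, fun β => ?_⟩
  have mF : ∀ n, n ∈ gF F0 β ↔ (∃ s ∈ R, acc s ∧ E s = n) ∨ ∃ i < β.length, 2 * i + 4 = n := by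
    intro n; simp [gF, mF0]
  have mS : ∀ t, t ∈ gS (E s1) (E s2) β ↔
      t = (2, E s1) ∨ t = (2, 4) ∨ t = (2 * β.length + 4, E s2) := by
    intro t; simp [gS]
  have mT : ∀ t, t ∈ gT T0 (E sa) β ↔ (∃ s ∈ R, ∃ b, (E s, dir s, b, E (next s b)) = t) ∨
      (∃ i < β.length, (2 * i + 4, false, β.getD i false, 2 * i + 6) = t) ∨
      ∃ i < β.length, (2 * i + 4, false, !(β.getD i false), E sa) = t := by
    intro t; simp only [gT, List.mem_append, mT0, List.mem_map, List.mem_range]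
  have E3 : ∀ s, 3 ≤ E s := fun s => by simp only [E]; omega
  have Eodd : ∀ s, E s % 2 = 1 := fun s => by simp only [E]; omega
  set F := gF F0 β
  set Sl := gS (E s1) (E s2) β
  set T := gT T0 (E sa) β
  refine ⟨⟨?_, ?_⟩, ?_⟩
  · intro t ht
    have := E3 s1
    have := E3 s2
    rcases (mS t).1 ht with rfl | rfl | rfl <;> constructor <;> dsimp only <;> omega
  · intro t ht
    have := E3 sa
    rcases (mT t).1 ht with ⟨s, hs, b, rfl⟩ | ⟨i, hi, rfl⟩ | ⟨i, hi, rfl⟩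
    · have := E3 s
      have := E3 (next s b)
      constructor <;> dsimp only <;> omega
    · constructor <;> dsimp only <;> omega
    · constructor <;> dsimp only <;> omega
  -- fixed part, one direction
  have fixA : ∀ s w, Acc2 dir next acc s w → s ∈ R → Lin F Sl T (E s) w := by
    intro s w h
    induction h with
    | nil s h => exact fun hs => Lin.nil _ ((mF _).2 (Or.inl ⟨s, hs, h, rfl⟩))
    | left s a v hd _ ih =>
      intro hs
      refine Lin.left _ (E (next s a)) a v ((mT _).2 (Or.inl ⟨s, hs, a, ?_⟩)) (ih (hcl s hs a))
      rw [hd]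
    | right s a v hd _ ih =>
      intro hs
      refine Lin.right _ (E (next s a)) a v ((mT _).2 (Or.inl ⟨s, hs, a, ?_⟩)) (ih (hcl s hs a))
      rw [hd]
  have fixB : ∀ q w, Lin F Sl T q w → ∀ s ∈ R, q = E s → Acc2 dir next acc s w := by
    intro q w h
    induction h with
    | nil q h =>
      rintro s hs rfl
      rcases (mF _).1 h with ⟨s', hs', ha', h'⟩ | ⟨i, hi, h'⟩
      · rw [← hE _ hs' _ hs h']; exact Acc2.nil _ ha'
      · have := Eodd s; omega
    | silent q q' v h _ ih =>
      rintro s hs rfl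
      have := Eodd s
      have := E3 s
      rcases (mS _).1 h with h | h | h <;> simp only [Prod.mk.injEq] at h <;> omega
    | left q q' a v h _ ih =>
      rintro s hs rfl
      have := Eodd s
      rcases (mT _).1 h with ⟨s', hs', b, h'⟩ | ⟨i, hi, h'⟩ | ⟨i, hi, h'⟩
      · simp only [Prod.mk.injEq] at h'
        obtain ⟨h1', h2', rfl, h4'⟩ := h'
        obtain rfl := hE _ hs' _ hs h1'
        exact Acc2.left _ _ _ h2' (ih _ (hcl _ hs _) h4'.symm)
      · simp only [Prod.mk.injEq] at h'; omega
      · simp only [Prod.mk.injEq] at h'; omega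
    | right q q' a v h _ ih =>
      rintro s hs rfl
      have := Eodd s
      rcases (mT _).1 h with ⟨s', hs', b, h'⟩ | ⟨i, hi, h'⟩ | ⟨i, hi, h'⟩
      · simp only [Prod.mk.injEq] at h'
        obtain ⟨h1', h2', rfl, h4'⟩ := h'
        obtain rfl := hE _ hs' _ hs h1'
        exact Acc2.right _ _ _ h2' (ih _ (hcl _ hs _) h4'.symm)
      · simp only [Prod.mk.injEq] at h'; omega
      · simp only [Prod.mk.injEq] at h'; omega
  have dropc : ∀ i, i < β.length → β.drop i = β.getD i false :: β.drop (i + 1) := by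
    intro i hi
    rw [List.drop_eq_getElem_cons hi]
    simp [List.getD, hi]
  have chA : ∀ w i, i ≤ β.length → (∀ v, w = β.drop i ++ v → Acc2 dir next acc s2 v) →
      Lin F Sl T (2 * i + 4) w := by
    intro w
    induction w with
    | nil =>
      intro i hi h
      rcases Nat.lt_or_ge i β.length with h' | h'
      · exact Lin.nil _ ((mF _).2 (Or.inr ⟨i, h', rfl⟩))
      · obtain rfl : i = β.length := by omega
        refine Lin.silent _ (E s2) _ ((mS _).2 (Or.inr (Or.inr rfl))) (fixA _ _ (h [] ?_) h2)
        simp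
    | cons a w ih =>
      intro i hi h
      rcases Nat.lt_or_ge i β.length with h' | h'
      · by_cases hab : a = β.getD i false
        · refine Lin.left _ (2 * i + 6) _ _ ((mT _).2 (Or.inr (Or.inl ⟨i, h', by rw [hab]⟩))) ?_
          refine ih (i + 1) h' ?_
          intro v hv
          refine h v ?_
          rw [dropc i h', hv, hab]
          rfl
        · refine Lin.left _ (E sa) _ _ ((mT _).2 (Or.inr (Or.inr ⟨i, h', ?_⟩)))
            (fixA _ _ (hacc _) ha)
          have : a = !(β.getD i false) := by
            revert hab; cases a <;> cases β.getD i false <;> simp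
          rw [this]
      · obtain rfl : i = β.length := by omega
        refine Lin.silent _ (E s2) _ ((mS _).2 (Or.inr (Or.inr rfl))) (fixA _ _ (h (a :: w) ?_) h2)
        simp
  have chB : ∀ q w, Lin F Sl T q w → ∀ i, i ≤ β.length → q = 2 * i + 4 →
      ∀ v, w = β.drop i ++ v → Acc2 dir next acc s2 v := by
    intro q w h
    induction h with
    | nil q h =>
      rintro i hi rfl v hv
      rcases (mF _).1 h with ⟨s', hs', ha', h'⟩ | ⟨j, hj, h'⟩
      · have := Eodd s'; omega
      · obtain rfl : j = i := by omega
        rw [dropc j hj] at hv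
        simp at hv
    | silent q q' w h hl ih =>
      rintro i hi rfl v hv
      have := Eodd s1
      rcases (mS _).1 h with h | h | h <;> simp only [Prod.mk.injEq] at h
      · omega
      · omega
      · obtain ⟨hq, rfl⟩ := h
        obtain rfl : i = β.length := by omega
        simp only [List.drop_length, List.nil_append] at hv
        subst hv
        exact fixB _ _ hl _ h2 rfl
    | left q q' a w h _ ih =>
      rintro i hi rfl v hv
      rcases (mT _).1 h with ⟨s', hs', b, h'⟩ | ⟨j, hj, h'⟩ | ⟨j, hj, h'⟩
      · simp only [Prod.mk.injEq] at h'
        have := Eodd s'; omega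
      · simp only [Prod.mk.injEq] at h'
        obtain ⟨h1', -, rfl, h4'⟩ := h'
        obtain rfl : j = i := by omega
        rw [dropc j hj] at hv
        simp only [List.cons_append, List.cons.injEq, true_and] at hv
        exact ih (j + 1) hj h4'.symm v hv
      · simp only [Prod.mk.injEq] at h'
        obtain ⟨h1', -, rfl, h4'⟩ := h'
        obtain rfl : j = i := by omega
        rw [dropc j hj] at hv
        simp at hv
    | right q q' a w h _ ih =>
      rintro i hi rfl v hv
      rcases (mT _).1 h with ⟨s', hs', b, h'⟩ | ⟨j, hj, h'⟩ | ⟨j, hj, h'⟩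
      · simp only [Prod.mk.injEq] at h'
        have := Eodd s'; omega
      · simp at h'
      · simp at h'
  intro w
  constructor
  · intro h
    have key : ∀ q w, Lin F Sl T q w → q = 2 → 
        Acc2 dir next acc s1 w ∨ ∀ v, w = β ++ v → Acc2 dir next acc s2 v := by
      intro q w h
      cases h with
      | nil q h =>
        rintro rfl
        rcases (mF _).1 h with ⟨s', hs', ha', h'⟩ | ⟨j, hj, h'⟩
        · have := Eodd s'; omega
        · omega
      | silent q q' w h hl =>
        rintro rfl
        rcases (mS _).1 h with h | h | h <;> simp only [Prod.mk.injEq] at h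
        · obtain ⟨-, rfl⟩ := h
          exact Or.inl (fixB _ _ hl _ h1 rfl)
        · obtain ⟨-, rfl⟩ := h
          exact Or.inr (chB _ _ hl 0 (Nat.zero_le _) rfl)
        · omega
      | left q q' a w h =>
        rintro rfl
        rcases (mT _).1 h with ⟨s', hs', b, h'⟩ | ⟨j, hj, h'⟩ | ⟨j, hj, h'⟩ <;>
          simp only [Prod.mk.injEq] at h'
        · have := Eodd s'; omega
        · omega
        · omega
      | right q q' a w h =>
        rintro rfl
        rcases (mT _).1 h with ⟨s', hs', b, h'⟩ | ⟨j, hj, h'⟩ | ⟨j, hj, h'⟩ <;>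
          simp only [Prod.mk.injEq] at h'
        · have := Eodd s'; omega
        · omega
        · omega
    exact key 2 w h rfl
  · rintro (h | h)
    · exact Lin.silent _ _ _ ((mS _).2 (Or.inl rfl)) (fixA _ _ h h1)
    · exact Lin.silent _ _ _ ((mS _).2 (Or.inr (Or.inl rfl)))
        (chA w 0 (Nat.zero_le _) (by simpa using h))
end checker

section letters
open Turing PartrecToTM2

/-- Letter-level states of the checkers. -/
inductive LS
  | cmp (q : Ctl) (p : List Ltr)
  | fin
  | acc
  | cp2 (o : Option Ltr)
  | dead

instance : Finite K' := by
  refine Finite.of_injective (β := Fin 4)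
    (fun k => match k with | K'.main => 0 | K'.rev => 1 | K'.aux => 2 | K'.stack => 3) ?_
  intro a b h
  cases a <;> cases b <;> simp_all

/-- Number of letters. -/
noncomputable def nK : ℕ := Nat.card Ltr

/-- Numbering of the letters. -/
noncomputable def ltrEquiv : Ltr ≃ Fin nK := Finite.equivFin Ltr

/-- Unary code of a letter. -/
noncomputable def cd (g : Ltr) : ℕ := (ltrEquiv g : ℕ) + 1

namespace LS

/-- Reaction to the middle marker. -/
def hsh : LS → LS
  | cmp .sink [] => fin
  | cp2 (some _) => dead
  | dead => dead
  | _ => acc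

/-- Reaction to a letter. -/
def lt : LS → Ltr → LS
  | cmp q [], g => cmp (del q g).1 (del q g).2
  | cmp q (b :: p), g => if g = b then cmp q p else acc
  | cp2 none, g => cp2 (some g)
  | cp2 (some b), g => if g = b then cp2 none else acc
  | dead, _ => dead
  | fin, _ => acc
  | acc, _ => acc

/-- Reaction to an invalid letter. -/
def bad : LS → LS
  | dead => dead
  | _ => acc

/-- Side read. -/
def dir : LS → Bool
  | cmp _ (_ :: _) => true
  | cp2 none => true
  | _ => false

/-- Reaction to a unary number. -/
noncomputable def nxt (s : LS) : ℕ → LS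
  | 0 => hsh s
  | c + 1 => if h : c < nK then lt s (ltrEquiv.symm ⟨c, h⟩) else bad s

end LS

/-- Bit level states. -/
abbrev BS := LS × ℕ

/-- Side read at bit level. -/
def bdir (s : BS) : Bool := s.1.dir

/-- Bit level transition. -/
noncomputable def bnext (s : BS) (b : Bool) : BS :=
  if b then (s.1, min (s.2 + 1) (nK + 1)) else (s.1.nxt s.2, 0)

/-- Acceptance at the empty word. -/
def bacc : BS → Prop
  | (LS.fin, c) => c ≠ 0
  | (LS.dead, _) => False
  | _ => True

/-- Bit-level acceptance. -/
abbrev AccB (s : LS) (c : ℕ) (w : List Bool) : Prop := Acc2 bdir bnext bacc (s, c) w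

/-- States which accept the empty word. -/
def LS.Live (s : LS) : Prop := ∀ c, bacc (s, c)

theorem LS.nxt_min (s : LS) (k : ℕ) : s.nxt (min k (nK + 1)) = s.nxt k := by
  rcases Nat.lt_or_ge k (nK + 1) with h | h
  · rw [min_eq_left h.le]
  · rw [min_eq_right h]
    obtain ⟨j, rfl⟩ : ∃ j, k = j + 1 := ⟨k - 1, by omega⟩
    have : ¬ j < nK := by omega
    simp [LS.nxt, this]

theorem LS.nxt_cd (s : LS) (g : Ltr) : s.nxt (cd g) = s.lt g := by
  simp [LS.nxt, cd]

theorem min_min_add (c k K : ℕ) : min (min (c + 1) K + k) K = min (c + (k + 1)) K := by omega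

theorem accB_lt {s : LS} (hs : s.dir = false) (c : ℕ) (v : List Bool) :
    AccB s c (true :: v) ↔ AccB s (min (c + 1) (nK + 1)) v :=
  acc2_left (s := (s, c)) (dir := bdir) hs true v

theorem accB_lf {s : LS} (hs : s.dir = false) (c : ℕ) (v : List Bool) :
    AccB s c (false :: v) ↔ AccB (s.nxt c) 0 v :=
  acc2_left (s := (s, c)) (dir := bdir) hs false v

theorem accB_rt {s : LS} (hs : s.dir = true) (c : ℕ) (v : List Bool) :
    AccB s c (v ++ [true]) ↔ AccB s (min (c + 1) (nK + 1)) v :=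
  acc2_right (s := (s, c)) (dir := bdir) hs true v

theorem accB_rf {s : LS} (hs : s.dir = true) (c : ℕ) (v : List Bool) :
    AccB s c (v ++ [false]) ↔ AccB (s.nxt c) 0 v :=
  acc2_right (s := (s, c)) (dir := bdir) hs false v

theorem left_step {s : LS} (hs : s.dir = false) (k : ℕ) : ∀ (c : ℕ) (v : List Bool),
    AccB s c (List.replicate k true ++ false :: v) ↔
      AccB (s.nxt (c + k)) 0 v := by
  induction k with
  | zero =>
    intro c v
    rw [List.replicate_zero, List.nil_append, accB_lf hs]
    rfl
  | succ k ih =>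
    intro c v
    rw [List.replicate_succ, List.cons_append, accB_lt hs]
    rw [ih, ← LS.nxt_min, min_min_add, LS.nxt_min]

theorem right_step {s : LS} (hs : s.dir = true) (k : ℕ) : ∀ (c : ℕ) (v : List Bool),
    AccB s c (v ++ (List.replicate k true ++ [false]).reverse) ↔
      AccB (s.nxt (c + k)) 0 v := by
  induction k with
  | zero =>
    intro c v
    rw [List.replicate_zero, List.nil_append, List.reverse_singleton, accB_rf hs]
    rfl
  | succ k ih =>
    intro c v
    rw [List.replicate_succ, List.cons_append, List.reverse_cons, ← List.append_assoc,
      accB_rt hs]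
    rw [ih, ← LS.nxt_min, min_min_add, LS.nxt_min]

theorem ones_or (w : List Bool) : (∃ k, w = List.replicate k true) ∨
    ∃ k v, w = List.replicate k true ++ false :: v := by
  induction w with
  | nil => exact Or.inl ⟨0, rfl⟩
  | cons a w ih =>
    cases a
    · exact Or.inr ⟨0, w, rfl⟩
    · rcases ih with ⟨k, rfl⟩ | ⟨k, v, rfl⟩
      · exact Or.inl ⟨k + 1, rfl⟩
      · exact Or.inr ⟨k + 1, v, rfl⟩

theorem live_ones {s : LS} (hl : s.Live) (k : ℕ) : ∀ c, AccB s c (List.replicate k true) := by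
  induction k with
  | zero => exact fun c => (acc2_nil _).2 (hl c)
  | succ k ih =>
    intro c
    cases hs : s.dir
    · rw [List.replicate_succ, accB_lt hs]
      exact ih _
    · rw [List.replicate_succ', accB_rt hs]
      exact ih _

theorem left_dec {s : LS} (hs : s.dir = false) (hl : s.Live) {w : List Bool} (h : ¬ AccB s 0 w) :
    ∃ k v, w = List.replicate k true ++ false :: v ∧ ¬ AccB (s.nxt k) 0 v := by
  rcases ones_or w with ⟨k, rfl⟩ | ⟨k, v, rfl⟩
  · exact absurd (live_ones hl k 0) h
  · rw [left_step hs, Nat.zero_add] at h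
    exact ⟨k, v, rfl, h⟩

theorem right_dec {s : LS} (hs : s.dir = true) (hl : s.Live) {w : List Bool} (h : ¬ AccB s 0 w) :
    ∃ k v, w = v ++ (List.replicate k true ++ [false]).reverse ∧ ¬ AccB (s.nxt k) 0 v := by
  rcases ones_or w.reverse with ⟨k, hk⟩ | ⟨k, v, hk⟩
  · have : w = List.replicate k true := by
      rw [← List.reverse_reverse w, hk, List.reverse_replicate]
    rw [this] at h
    exact absurd (live_ones hl k 0) h
  · have : w = v.reverse ++ (List.replicate k true ++ [false]).reverse := by
      rw [← List.reverse_reverse w, hk]; simp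
    rw [this, right_step hs, Nat.zero_add] at h
    exact ⟨k, _, this, h⟩

theorem acc_all : ∀ (w : List Bool) (c : ℕ), AccB LS.acc c w := by
  have hn : ∀ k, LS.acc.nxt k = LS.acc := by
    intro k
    cases k with
    | zero => rfl
    | succ k => simp [LS.nxt, LS.lt, LS.bad]
  intro w
  induction w with
  | nil => exact fun c => (acc2_nil _).2 trivial
  | cons a w ih =>
    intro c
    cases a
    · rw [accB_lf rfl, hn]; exact ih _
    · rw [accB_lt rfl]; exact ih _

theorem dead_all : ∀ (w : List Bool) (c : ℕ), ¬ AccB LS.dead c w := by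
  have hn : ∀ k, LS.dead.nxt k = LS.dead := by
    intro k
    cases k with
    | zero => rfl
    | succ k => simp [LS.nxt, LS.lt, LS.bad]
  intro w
  induction w with
  | nil => exact fun c h => (acc2_nil _).1 h
  | cons a w ih =>
    intro c
    cases a
    · rw [accB_lf rfl, hn]; exact ih _
    · rw [accB_lt rfl]; exact ih _

theorem fin_iff (w : List Bool) : ¬ AccB LS.fin 0 w ↔ w = [] := by
  have hn : ∀ k, LS.fin.nxt k = LS.acc := by
    intro k
    cases k with
    | zero => rfl
    | succ k => simp [LS.nxt, LS.lt, LS.bad]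
  have h1 : ∀ (w : List Bool) (c : ℕ), c ≠ 0 → AccB LS.fin c w := by
    intro w
    induction w with
    | nil => exact fun c hc => (acc2_nil _).2 hc
    | cons a w ih =>
      intro c hc
      cases a
      · rw [accB_lf rfl, hn]; exact acc_all _ _
      · rw [accB_lt rfl]; exact ih _ (by omega)
  constructor
  · intro h
    cases w with
    | nil => rfl
    | cons a w =>
      exfalso
      apply h
      cases a
      · rw [accB_lf rfl, hn]; exact acc_all _ _
      · rw [accB_lt rfl]; exact h1 _ _ (by omega)
  · rintro rfl h
    exact (acc2_nil _).1 h rfl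

/-- Unary letter. -/
noncomputable def lb (g : Ltr) : List Bool := List.replicate (cd g) true ++ [false]

/-- Encoding of words. -/
noncomputable def enc (x : List Ltr) : List Bool := x.flatMap lb

theorem enc_cons (g : Ltr) (x : List Ltr) : enc (g :: x) = lb g ++ enc x := rfl

theorem enc_append (x y : List Ltr) : enc (x ++ y) = enc x ++ enc y := by simp [enc]

theorem left_lb {s : LS} (hs : s.dir = false) (g : Ltr) (v : List Bool) :
    AccB s 0 (lb g ++ v) ↔ AccB (s.lt g) 0 v := by
  have : lb g ++ v = List.replicate (cd g) true ++ false :: v := by simp [lb]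
  rw [this, left_step hs, Nat.zero_add, LS.nxt_cd]

theorem right_lb {s : LS} (hs : s.dir = true) (g : Ltr) (v : List Bool) :
    AccB s 0 (v ++ (lb g).reverse) ↔ AccB (s.lt g) 0 v := by
  rw [lb, right_step hs, Nat.zero_add, LS.nxt_cd]

theorem left_hash {s : LS} (hs : s.dir = false) (v : List Bool) :
    AccB s 0 (false :: v) ↔ AccB s.hsh 0 v := left_step hs 0 0 v

theorem right_hash {s : LS} (hs : s.dir = true) (v : List Bool) :
    AccB s 0 (v ++ [false]) ↔ AccB s.hsh 0 v := right_step hs 0 0 v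

theorem num_cases (k : ℕ) : k = 0 ∨ (∃ g, k = cd g) ∨ ∀ s : LS, s.nxt k = s.bad := by
  cases k with
  | zero => exact Or.inl rfl
  | succ k =>
    by_cases h : k < nK
    · exact Or.inr (Or.inl ⟨ltrEquiv.symm ⟨k, h⟩, by simp [cd]⟩)
    · exact Or.inr (Or.inr fun s => by simp [LS.nxt, h])

theorem live_cmp (q : Ctl) (p : List Ltr) : (LS.cmp q p).Live := fun _ => trivial

theorem cmp_rej (n : ℕ) : ∀ (q : Ctl) (p : List Ltr) (w : List Bool), w.length ≤ n →
    ¬ AccB (LS.cmp q p) 0 w → ∃ x, w = enc x ++ false :: (enc (p ++ out del q x)).reverse ∧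
      ost del q x = .sink := by
  induction n with
  | zero =>
    intro q p w hw h
    obtain rfl : w = [] := List.eq_nil_of_length_eq_zero (by omega)
    exact absurd ((acc2_nil _).2 (live_cmp q p 0)) h
  | succ n ih =>
    intro q p w hw h
    cases p with
    | nil =>
      obtain ⟨k, v, rfl, h'⟩ := left_dec rfl (live_cmp q []) h
      rcases num_cases k with rfl | ⟨g, rfl⟩ | hb
      · have : q = .sink ∧ v = [] := by
          cases q with
          | sink => exact ⟨rfl, (fin_iff v).1 h'⟩
          | fresh q v => exact absurd (acc_all _ _) h'
          | copy q v => exact absurd (acc_all _ _) h'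
        obtain ⟨rfl, rfl⟩ := this
        exact ⟨[], by simp [enc, out], rfl⟩
      · rw [LS.nxt_cd] at h'
        obtain ⟨x, hx, hs⟩ := ih _ _ v (by simp at hw; omega) h'
        refine ⟨g :: x, ?_, hs⟩
        rw [hx]
        simp [enc_cons, lb, out]
      · rw [hb] at h'
        exact absurd (acc_all _ _) h'
    | cons b p =>
      obtain ⟨k, v, rfl, h'⟩ := right_dec rfl (live_cmp q (b :: p)) h
      rcases num_cases k with rfl | ⟨g, rfl⟩ | hb
      · exfalso
        apply h'
        have : (LS.cmp q (b :: p)).nxt 0 = LS.acc := by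
          cases q <;> rfl
        rw [this]
        exact acc_all _ _
      · rw [LS.nxt_cd] at h'
        by_cases hg : g = b
        · have : (LS.cmp q (b :: p)).lt g = LS.cmp q p := by simp [LS.lt, hg]
          rw [this] at h'
          obtain ⟨x, hx, hs⟩ := ih _ _ v (by simp at hw; omega) h'
          refine ⟨x, ?_, hs⟩
          rw [hx, ← hg]
          simp [enc_cons, lb]
        · have : (LS.cmp q (b :: p)).lt g = LS.acc := by simp [LS.lt, hg]
          rw [this] at h'
          exact absurd (acc_all _ _) h'
      · rw [hb] at h'
        exact absurd (acc_all _ _) h'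

theorem pend_step (q : Ctl) (p y : List Ltr) (w : List Bool) :
    AccB (LS.cmp q p) 0 (w ++ (enc (p ++ y)).reverse) ↔
      AccB (LS.cmp q []) 0 (w ++ (enc y).reverse) := by
  induction p with
  | nil => rfl
  | cons b p ih =>
    rw [List.cons_append, enc_cons, List.reverse_append, ← List.append_assoc, right_lb rfl]
    have : (LS.cmp q (b :: p)).lt b = LS.cmp q p := by simp [LS.lt]
    rw [this, ih]

theorem cmp_of (x : List Ltr) : ∀ q, ost del q x = .sink →
    ¬ AccB (LS.cmp q []) 0 (enc x ++ false :: (enc (out del q x)).reverse) := by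
  induction x with
  | nil =>
    intro q hq
    obtain rfl : q = .sink := hq
    exact (fin_iff []).2 rfl ∘ (left_hash rfl _).1
  | cons g x ih =>
    intro q hq
    rw [enc_cons, List.append_assoc, left_lb rfl]
    have h1 : (LS.cmp q []).lt g = LS.cmp (del q g).1 (del q g).2 := rfl
    have h2 : out del q (g :: x) = (del q g).2 ++ out del (del q g).1 x := rfl
    rw [h1, h2]
    have h3 : ∀ z : List Bool, enc x ++ false :: z = (enc x ++ [false]) ++ z := by simp
    rw [h3, pend_step, ← h3]
    exact ih _ hq

theorem cp2_iff (x : List Ltr) : ∀ y : List Ltr,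
    ¬ AccB (LS.cp2 none) 0 (enc x ++ false :: (enc y).reverse) ↔ ∃ b, (x ++ [b]) <+: y := by
  induction x with
  | nil =>
    intro y
    cases y with
    | nil =>
      constructor
      · exact fun h => absurd ((right_hash (s := LS.cp2 none) rfl []).2 (acc_all _ _)) h
      · simp
    | cons g y =>
      have h3 : (enc [] ++ false :: (enc (g :: y)).reverse) =
          (false :: (enc y).reverse) ++ (lb g).reverse := by simp [enc]
      rw [h3, right_lb rfl]
      have h1 : (LS.cp2 none).lt g = LS.cp2 (some g) := rfl
      rw [h1, left_hash rfl]
      exact ⟨fun _ => ⟨g, by simp⟩, fun _ => dead_all _ _⟩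
  | cons a x ih =>
    intro y
    cases y with
    | nil =>
      constructor
      · exact fun h => absurd ((right_hash (s := LS.cp2 none) rfl _).2 (acc_all _ _)) h
      · simp
    | cons g y =>
      have h3 : (enc (a :: x) ++ false :: (enc (g :: y)).reverse) =
          (lb a ++ (enc x ++ false :: (enc y).reverse)) ++ (lb g).reverse := by simp [enc]
      rw [h3, right_lb rfl]
      have h1 : (LS.cp2 none).lt g = LS.cp2 (some g) := rfl
      rw [h1, left_lb rfl]
      by_cases hg : a = g
      · have : (LS.cp2 (some g)).lt a = LS.cp2 none := by simp [LS.lt, hg]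
        rw [this, ih, hg]
        simp
      · have : (LS.cp2 (some g)).lt a = LS.acc := by simp [LS.lt, hg]
        rw [this]
        simp [acc_all, hg]

theorem rep_inj (m : ℕ) : ∀ (n : ℕ) (u v : List Bool),
    List.replicate m true ++ false :: u = List.replicate n true ++ false :: v → m = n ∧ u = v := by
  induction m with
  | zero =>
    intro n u v h
    cases n with
    | zero => simpa using h
    | succ n => simp [List.replicate_succ] at h
  | succ m ih =>
    intro n u v h
    cases n with
    | zero => simp [List.replicate_succ] at h
    | succ n =>
      simp only [List.replicate_succ, List.cons_append, List.cons.injEq, true_and] at h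
      have := ih n u v h
      exact ⟨by omega, this.2⟩

theorem enc_prefix (z : List Ltr) : ∀ (x : List Ltr) (r v : List Bool),
    enc x ++ false :: r = enc z ++ v → ∃ x', x = z ++ x' := by
  induction z with
  | nil => exact fun x _ _ _ => ⟨x, rfl⟩
  | cons a z ih =>
    intro x r v h
    have h0 : enc (a :: z) ++ v = List.replicate (cd a) true ++ false :: (enc z ++ v) := by
      simp [enc_cons, lb]
    cases x with
    | nil =>
      rw [h0] at h
      have := rep_inj 0 (cd a) _ _ h
      simp [cd] at this
    | cons b x =>
      have h1 : enc (b :: x) ++ false :: r =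
          List.replicate (cd b) true ++ false :: (enc x ++ false :: r) := by
        simp [enc_cons, lb]
      rw [h0, h1] at h
      obtain ⟨hab, hrest⟩ := rep_inj _ _ _ _ h
      obtain rfl : b = a := by
        apply ltrEquiv.injective
        apply Fin.ext
        simpa [cd] using hab
      obtain ⟨x', rfl⟩ := ih x r v hrest
      exact ⟨x', rfl⟩

theorem word_iff (c : ToPartrec.Code) (n : ℕ) :
    (∀ w, AccB (LS.cmp (q0 c) []) 0 w ∨ ∀ v, w = enc (ini n) ++ v → AccB (LS.cp2 none) 0 v) ↔
      ¬ (ToPartrec.Code.eval c [n]).Dom := by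
  rw [← hist]
  constructor
  · rintro h ⟨x, b, h1, h2⟩
    rcases h (enc (ini n ++ x) ++ false :: (enc (out del (q0 c) (ini n ++ x))).reverse) with h | h
    · exact cmp_of _ _ h1 h
    · refine (cp2_iff x (out del (q0 c) (ini n ++ x))).2 ⟨b, h2⟩ (h _ ?_)
      rw [enc_append, List.append_assoc]
  · intro h w
    by_contra hc
    push Not at hc
    obtain ⟨h1, v, rfl, h2⟩ := hc
    obtain ⟨x, hx, hs⟩ := cmp_rej _ _ _ _ le_rfl h1
    obtain ⟨x', rfl⟩ := enc_prefix _ _ _ _ hx.symm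
    rw [enc_append, List.append_assoc, List.append_cancel_left_eq] at hx
    rw [hx, cp2_iff] at h2
    obtain ⟨b, hb⟩ := h2
    exact h ⟨x', b, hs, hb⟩
end letters

section generic
variable {K : Type} {Γ : K → Type} {Λ σ : Type}
open Turing

theorem stm_push (k : K) (f : σ → Γ k) (q : TM2.Stmt Γ Λ σ) :
    q ∈ TM2.stmts₁ (TM2.Stmt.push k f q) := by simp [TM2.stmts₁, TM2.stmts₁_self]

theorem stm_peek (k : K) (f : σ → Option (Γ k) → σ) (q : TM2.Stmt Γ Λ σ) :
    q ∈ TM2.stmts₁ (TM2.Stmt.peek k f q) := by simp [TM2.stmts₁, TM2.stmts₁_self]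

theorem stm_pop (k : K) (f : σ → Option (Γ k) → σ) (q : TM2.Stmt Γ Λ σ) :
    q ∈ TM2.stmts₁ (TM2.Stmt.pop k f q) := by simp [TM2.stmts₁, TM2.stmts₁_self]

theorem stm_load (f : σ → σ) (q : TM2.Stmt Γ Λ σ) :
    q ∈ TM2.stmts₁ (TM2.Stmt.load f q) := by simp [TM2.stmts₁, TM2.stmts₁_self]

theorem stm_branch₁ (f : σ → Bool) (q₁ q₂ : TM2.Stmt Γ Λ σ) :
    q₁ ∈ TM2.stmts₁ (TM2.Stmt.branch f q₁ q₂) := by simp [TM2.stmts₁, TM2.stmts₁_self]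

theorem stm_branch₂ (f : σ → Bool) (q₁ q₂ : TM2.Stmt Γ Λ σ) :
    q₂ ∈ TM2.stmts₁ (TM2.Stmt.branch f q₁ q₂) := by simp [TM2.stmts₁, TM2.stmts₁_self]

theorem stm_self (M : Λ → TM2.Stmt Γ Λ σ) (S : Finset Λ) (l : Λ) (h : l ∈ S) :
    some (M l) ∈ TM2.stmts M S := by
  simp only [TM2.stmts, Finset.mem_insertNone, Finset.mem_biUnion, Option.mem_def,
    Option.some.injEq, forall_eq']
  exact ⟨l, h, TM2.stmts₁_self⟩
end generic

section finiteness
open Turing PartrecToTM2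

/-- Reachable statements. -/
def GoodS (c : ToPartrec.Code) (q : Stmt') : Prop :=
  some q ∈ TM2.stmts tr (codeSupp c Cont'.halt)

/-- Reachable control states. -/
def GoodC (c : ToPartrec.Code) : Ctl → Prop
  | .fresh q _ => GoodS c q
  | .copy q _ => GoodS c q
  | .sink => True

/-- Reachable letter-level states. -/
def GoodL (c : ToPartrec.Code) : LS → Prop
  | .cmp q p => GoodC c q ∧ p.length ≤ 2
  | _ => True

theorem finite_goodS (c : ToPartrec.Code) : {q | GoodS c q}.Finite :=
  Set.Finite.preimage (f := some) (fun _ _ _ _ h => Option.some.inj h)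
    (TM2.stmts tr (codeSupp c Cont'.halt)).finite_toSet

theorem finite_goodC (c : ToPartrec.Code) : {q | GoodC c q}.Finite := by
  have h1 : (Set.image2 Ctl.fresh {q | GoodS c q} Set.univ).Finite :=
    (finite_goodS c).image2 _ Set.finite_univ
  have h2 : (Set.image2 Ctl.copy {q | GoodS c q} Set.univ).Finite :=
    (finite_goodS c).image2 _ Set.finite_univ
  refine ((h1.union h2).union (Set.finite_singleton Ctl.sink)).subset ?_
  rintro (⟨q, v⟩ | ⟨q, v⟩ | _) h
  · exact Or.inl (Or.inl ⟨q, h, v, trivial, rfl⟩)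
  · exact Or.inl (Or.inr ⟨q, h, v, trivial, rfl⟩)
  · exact Or.inr rfl

theorem finite_goodL (c : ToPartrec.Code) : {s | GoodL c s}.Finite := by
  have h1 : (Set.image2 LS.cmp {q | GoodC c q} {p : List Ltr | p.length ≤ 2}).Finite :=
    (finite_goodC c).image2 _ (List.finite_length_le _ _)
  have h2 : (LS.cp2 '' Set.univ).Finite := Set.finite_univ.image _
  have h3 : ({LS.fin, LS.acc, LS.dead} : Set LS).Finite := by simp
  refine ((h1.union h2).union h3).subset ?_
  rintro (⟨q, p⟩ | _ | _ | o | _) h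
  · exact Or.inl (Or.inl ⟨q, h.1, p, h.2, rfl⟩)
  · exact Or.inr (by simp)
  · exact Or.inr (by simp)
  · exact Or.inl (Or.inr ⟨o, trivial, rfl⟩)
  · exact Or.inr (by simp)

theorem goodC_cp {c : ToPartrec.Code} {q : Stmt'} (h : GoodS c q) (v : Option Γ') (a : Ltr) :
    GoodC c (cp q v a) := by
  cases a <;> exact h

theorem goodS_tr {c : ToPartrec.Code} {l : Λ'} (h : l ∈ codeSupp c Cont'.halt) :
    GoodS c (tr l) := stm_self _ _ _ h

theorem goodC_del (c : ToPartrec.Code) (q : Ctl) (hq : GoodC c q) (a : Ltr) :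
    GoodC c (del q a).1 ∧ (del q a).2.length ≤ 2 := by
  have sub : ∀ q q' : Stmt', GoodS c q' → q ∈ TM2.stmts₁ q' → GoodS c q :=
    fun q q' h h' => TM2.stmts_trans h' h
  rcases q with ⟨q, v⟩ | ⟨q, v⟩ | _
  · have hq' : GoodS c q := hq
    cases q with
    | push k f q =>
      have := sub q _ hq' (stm_push _ _ _)
      exact ⟨goodC_cp this _ _, by simp [del]⟩
    | peek k f q =>
      have := sub q _ hq' (stm_peek _ _ _)
      rcases a with _ | ⟨k', g⟩
      · exact ⟨this, by simp [del]⟩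
      · by_cases hk : k' = k
        · simp only [del, hk, if_true]; exact ⟨this, by simp⟩
        · simp only [del, hk, if_false]; exact ⟨hq, by simp⟩
    | pop k f q =>
      have := sub q _ hq' (stm_pop _ _ _)
      rcases a with _ | ⟨k', g⟩
      · exact ⟨this, by simp [del]⟩
      · by_cases hk : k' = k
        · simp only [del, hk, if_true]; exact ⟨this, by simp⟩
        · simp only [del, hk, if_false]; exact ⟨hq, by simp⟩
    | load f q =>
      have := sub q _ hq' (stm_load _ _)
      exact ⟨goodC_cp this _ _, by simp [del]⟩
    | branch f q₁ q₂ =>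
      have h1 := sub q₁ _ hq' (stm_branch₁ _ _ _)
      have h2 := sub q₂ _ hq' (stm_branch₂ _ _ _)
      refine ⟨goodC_cp ?_ _ _, by simp [del]⟩
      cases f v
      · exact h2
      · exact h1
    | goto l =>
      refine ⟨goodC_cp (goodS_tr ?_) _ _, by simp [del]⟩
      have := @TM2.stmts_supportsStmt _ _ _ _ ⟨trNormal c Cont'.halt⟩ _ _ _
        (tr_supports c Cont'.halt) hq'
      exact this v
    | halt => exact ⟨trivial, by simp [del]⟩
  · exact ⟨goodC_cp hq _ _, by simp [del]⟩
  · exact ⟨trivial, by simp [del]⟩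

theorem goodC_q0 (c : ToPartrec.Code) : GoodC c (q0 c) :=
  goodS_tr (@tr_supports c Cont'.halt).1

theorem goodL_lt (c : ToPartrec.Code) (s : LS) (hs : GoodL c s) (g : Ltr) : GoodL c (s.lt g) := by
  rcases s with ⟨q, _ | ⟨b, p⟩⟩ | _ | _ | (_ | o) | _
  · exact goodC_del c q hs.1 g
  · by_cases hg : g = b
    · simp only [LS.lt, hg, if_true]
      exact ⟨hs.1, by have := hs.2; simp at this; omega⟩
    · simp only [LS.lt, hg, if_false]; trivial
  · trivial
  · trivial
  · trivial
  · by_cases hg : g = o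
    · simp only [LS.lt, hg, if_true]; trivial
    · simp only [LS.lt, hg, if_false]; trivial
  · trivial

theorem goodL_hsh (c : ToPartrec.Code) (s : LS) : GoodL c s.hsh := by
  rcases s with ⟨_ | _ | _, _ | ⟨b, p⟩⟩ | _ | _ | (_ | o) | _ <;> trivial

theorem goodL_bad (c : ToPartrec.Code) (s : LS) : GoodL c s.bad := by
  rcases s with _ | _ | _ | _ | _ <;> trivial

theorem goodL_nxt (c : ToPartrec.Code) (s : LS) (hs : GoodL c s) (k : ℕ) : GoodL c (s.nxt k) := by
  cases k with
  | zero => exact goodL_hsh c s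
  | succ k =>
    by_cases h : k < nK
    · simp only [LS.nxt, h, dif_pos]; exact goodL_lt c s hs _
    · simp only [LS.nxt, h]; exact goodL_bad c s

theorem main_lin (c : ToPartrec.Code) :
    ∃ (F0 : List ℕ) (T0 : List (ℕ × Bool × Bool × ℕ)) (e1 e2 ea : ℕ), ∀ n : ℕ,
      (∀ w, (codeToPIA (build (gF F0 (enc (ini n))) (gS e1 e2 (enc (ini n)))
        (gT T0 ea (enc (ini n))))).Accepts w) ↔ ¬ (ToPartrec.Code.eval c [n]).Dom := by
  let R : Set BS := {s | GoodL c s} ×ˢ Set.Iic (nK + 1)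
  have hR : R.Finite := (finite_goodL c).prod (Set.finite_Iic _)
  obtain ⟨F0, T0, e1, e2, ea, h⟩ := checker_lin (dir := bdir) (next := bnext) (acc := bacc) R hR
    (by
      rintro ⟨s, k⟩ ⟨h1, h2⟩ b
      cases b
      · exact ⟨goodL_nxt c s h1 k, Nat.zero_le _⟩
      · exact ⟨h1, by simp [bnext]⟩)
    (LS.cmp (q0 c) [], 0) (LS.cp2 none, 0) (LS.acc, 0)
    ⟨⟨goodC_q0 c, Nat.zero_le _⟩, Nat.zero_le _⟩ ⟨trivial, Nat.zero_le _⟩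
    ⟨trivial, Nat.zero_le _⟩ (fun w => acc_all w 0)
  refine ⟨F0, T0, e1, e2, ea, fun n => ?_⟩
  obtain ⟨hwf, hl⟩ := h (enc (ini n))
  rw [← word_iff]
  refine (pia_iff hwf).trans ?_
  exact forall_congr' hl
end finiteness

section final
open Turing PartrecToTM2

theorem trNat_bit (b : Bool) (n : ℕ) (h : n ≠ 0 ∨ b = true) :
    trNat (Nat.bit b n) = cond b Γ'.bit1 Γ'.bit0 :: trNat n := by
  unfold trNat
  rw [← Num.ofNat'_eq, ← Num.ofNat'_eq, Num.ofNat'_bit]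
  have h0 : Num.ofNat' n = 0 → n = 0 := by
    intro h
    rw [Num.ofNat'_eq] at h
    exact_mod_cast h
  rcases hn : Num.ofNat' n with _ | p
  · have := h0 hn
    obtain rfl : b = true := by simpa [this] using h
    rfl
  · cases b <;> rfl

/-- Bits of a digit. -/
noncomputable def dig (g : Γ') : List Bool := lb (some (K'.main, g))

/-- Bits of a number. -/
noncomputable def nbits (n : ℕ) : List Bool := (trNat n).flatMap dig

theorem enc_ini (n : ℕ) : enc (ini n) = nbits n ++ (dig Γ'.cons ++ lb none) := by
  have : trList [n] = trNat n ++ [Γ'.cons] := rfl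
  simp only [ini, blk, initU, this, enc, nbits, dig, List.map_append, List.flatMap_append,
    List.map_map, List.flatMap_map, Function.comp_def]
  simp
  rfl

theorem nbits_bit (b : Bool) (n : ℕ) (h : n ≠ 0 ∨ b = true) :
    nbits (Nat.bit b n) = cond b (dig Γ'.bit1) (dig Γ'.bit0) ++ nbits n := by
  unfold nbits
  rw [trNat_bit b n h]
  cases b <;> rfl

theorem nbits_primrec : Primrec nbits := by
  let g : Unit → List (List Bool) → Option (List Bool) := fun _ l =>
    if l.length = 0 then some [] else
      (l[l.length.div2]?).map (fun r => cond l.length.bodd (dig Γ'.bit1) (dig Γ'.bit0) ++ r)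
  have hl : Primrec (fun p : Unit × List (List Bool) => p.2.length) :=
    Primrec.list_length.comp Primrec.snd
  have hg : Primrec₂ g := by
    refine Primrec.ite (PrimrecRel.comp Primrec.eq hl (Primrec.const 0))
      (Primrec.const _) ?_
    refine Primrec.option_map
      (Primrec.list_getElem?.comp Primrec.snd (Primrec.nat_div2.comp hl)) ?_
    exact Primrec.list_append.comp
      (Primrec.cond (Primrec.nat_bodd.comp (hl.comp Primrec.fst)) (Primrec.const _)
        (Primrec.const _)) Primrec.snd
  have := Primrec.nat_strong_rec (fun (_ : Unit) n => nbits n) hg (by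
    intro a n
    simp only [g, List.length_map, List.length_range]
    by_cases hn : n = 0
    · subst hn; rfl
    · rw [if_neg hn]
      have hlt : n.div2 < n := by rw [Nat.div2_val]; omega
      have : (List.map nbits (List.range n))[n.div2]? = some (nbits n.div2) := by
        simp [hlt]
      rw [this]
      simp only [Option.map_some, Option.some.injEq]
      rw [← nbits_bit, Nat.bit_bodd_div2]
      by_contra hc
      push Not at hc
      apply hn
      rw [← Nat.bit_bodd_div2 n, hc.1]
      have := hc.2
      cases hb : n.bodd
      · rfl
      · exact absurd hb this)
  exact this.comp (Primrec.const ()) Primrec.id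

theorem enc_ini_primrec : Primrec (fun n => enc (ini n)) := by
  have : (fun n => enc (ini n)) = fun n => nbits n ++ (dig Γ'.cons ++ lb none) :=
    funext enc_ini
  rw [this]
  exact Primrec.list_append.comp nbits_primrec (Primrec.const _)

theorem code_primrec (F0 : List ℕ) (T0 : List (ℕ × Bool × Bool × ℕ)) (e1 e2 ea : ℕ) :
    Primrec (fun β : List Bool => build (gF F0 β) (gS e1 e2 β) (gT T0 ea β)) := by
  have hr : Primrec (fun β : List Bool => List.range β.length) :=
    Primrec.list_range.comp Primrec.list_length
  have h24 : Primrec (fun i : ℕ => 2 * i + 4) :=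
    Primrec.nat_add.comp (Primrec.nat_mul.comp (Primrec.const 2) Primrec.id) (Primrec.const 4)
  have h26 : Primrec (fun i : ℕ => 2 * i + 6) :=
    Primrec.nat_add.comp (Primrec.nat_mul.comp (Primrec.const 2) Primrec.id) (Primrec.const 6)
  have hF : Primrec (fun β : List Bool => gF F0 β) :=
    Primrec.list_append.comp (Primrec.const F0)
      (Primrec.list_map hr (h24.comp Primrec.snd))
  have hS : Primrec (fun β : List Bool => gS e1 e2 β) :=
    Primrec.list_cons.comp (Primrec.const _) (Primrec.list_cons.comp (Primrec.const _)
      (Primrec.list_cons.comp (Primrec.pair (h24.comp Primrec.list_length) (Primrec.const e2))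
        (Primrec.const [])))
  have hget : Primrec (fun p : List Bool × ℕ => p.1.getD p.2 false) :=
    (Primrec.list_getD false).comp Primrec.fst Primrec.snd
  have hT : Primrec (fun β : List Bool => gT T0 ea β) := by
    refine Primrec.list_append.comp (Primrec.const T0) (Primrec.list_append.comp
      (Primrec.list_map hr ?_) (Primrec.list_map hr ?_))
    · exact Primrec.pair (h24.comp Primrec.snd) (Primrec.pair (Primrec.const false)
        (Primrec.pair hget (h26.comp Primrec.snd)))
    · exact Primrec.pair (h24.comp Primrec.snd) (Primrec.pair (Primrec.const false)
        (Primrec.pair (Primrec.not.comp hget) (Primrec.const ea)))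
  have hmv : Primrec mvOf := by
    have hite : Primrec (fun t : ℕ × Bool × Bool × ℕ => if t.2.1 = true then 1 else 0) :=
      Primrec.ite (PrimrecRel.comp Primrec.eq (Primrec.fst.comp Primrec.snd) (Primrec.const true))
        (Primrec.const 1) (Primrec.const 0)
    exact Primrec.pair Primrec.fst (Primrec.pair hite (Primrec.pair (Primrec.const 1)
      (Primrec.pair (Primrec.const 2) (Primrec.snd.comp Primrec.snd))))
  refine Primrec.pair (Primrec.const 2) (Primrec.pair (Primrec.const 0) (Primrec.pair ?_
    (Primrec.pair hS ?_)))
  · exact Primrec.list_cons.comp (Primrec.const 0) (Primrec.list_cons.comp (Primrec.const 1) hF)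
  · exact Primrec.list_append.comp (Primrec.list_map hT (hmv.comp Primrec.snd))
      (Primrec.const startMoves)

theorem univ_undec : ¬ ComputablePred (fun c : PIACode =>
    ∀ w : List Bool, (codeToPIA c).Accepts w) := by
  intro hcomp
  let f : ℕ →. ℕ := fun k => Nat.Partrec.Code.eval (Denumerable.ofNat Nat.Partrec.Code k) 0
  have hf : Partrec f :=
    Nat.Partrec.Code.eval_part.comp (Computable.ofNat _) (Computable.const 0)
  obtain ⟨c, hc⟩ := ToPartrec.Code.exists_code (Nat.Partrec'.part_iff₁.2 hf)
  obtain ⟨F0, T0, e1, e2, ea, h⟩ := main_lin c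
  refine ComputablePred.halting_problem 0 ?_
  have hdom : ∀ d : Nat.Partrec.Code,
      (ToPartrec.Code.eval c [Encodable.encode d]).Dom ↔ (d.eval 0).Dom := by
    intro d
    have h1 := hc (List.Vector.cons (Encodable.encode d) List.Vector.nil)
    have h2 : ToPartrec.Code.eval c [Encodable.encode d] =
        pure <$> f (Encodable.encode d) := h1
    rw [h2]
    have h3 : f (Encodable.encode d) = d.eval 0 := by
      simp only [f, Denumerable.ofNat_encode]
    rw [h3]
    rfl
  have hred : ComputablePred (fun d : Nat.Partrec.Code => ¬ (d.eval 0).Dom) := by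
    refine ComputablePred.computable_of_manyOneReducible ⟨fun d =>
      build (gF F0 (enc (ini (Encodable.encode d)))) (gS e1 e2 (enc (ini (Encodable.encode d))))
        (gT T0 ea (enc (ini (Encodable.encode d)))), ?_, ?_⟩ hcomp
    · exact ((code_primrec F0 T0 e1 e2 ea).comp
        (enc_ini_primrec.comp Primrec.encode)).to_comp
    · intro d
      rw [h, hdom]
  exact hred.not.of_eq (fun d => not_not)

/-- A code of a universal automaton. -/
def uCode : PIACode := (1, 0, [0], [], [(0, 0, 0, 0, true, 0), (0, 0, 0, 0, false, 0)])

theorem uCode_accepts (w : List Bool) : (codeToPIA uCode).Accepts w := by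
  have key : ∀ k, k ≤ w.length → ∃ ρ : Fin 1 → Option (Fin w.length),
      Relation.ReflTransGen (PIAStep (codeToPIA uCode) w.get)
        (PIAInit (codeToPIA uCode) w.length)
        (⟨(0 : ℕ), ρ, {ℓ | ℓ.1 < k}⟩ : PIAConfig (codeToPIA uCode) w.length) := by
    intro k
    induction k with
    | zero =>
      intro _
      refine ⟨fun _ => none, ?_⟩
      have : (PIAInit (codeToPIA uCode) w.length) =
        (⟨(0 : ℕ), fun _ => none, {ℓ | ℓ.1 < 0}⟩ : PIAConfig (codeToPIA uCode) w.length) := by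
        unfold PIAInit
        congr 1
        ext ℓ
        simp
      rw [this]
      exact Relation.ReflTransGen.refl
    | succ k ih =>
      intro hk
      obtain ⟨ρ, hρ⟩ := ih (by omega)
      refine ⟨Function.update ρ 0 (some ⟨k, hk⟩), hρ.tail (Or.inr ?_)⟩
      refine ⟨(0 : Fin 1), none, none, ⟨k, hk⟩, ?_, ?_, trivial, trivial, rfl, ?_⟩
      · change ((0 : ℕ), (0 : ℕ), (0 : ℕ), (0 : ℕ), w.get ⟨k, hk⟩, (0 : ℕ)) ∈
          [(0, 0, 0, 0, true, 0), (0, 0, 0, 0, false, 0)]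
        cases w.get ⟨k, hk⟩ <;> simp
      · simp
      · ext ℓ
        simp [Fin.ext_iff]
        omega
  obtain ⟨ρ, hρ⟩ := key w.length le_rfl
  refine ⟨_, hρ, ?_, ?_⟩
  · change (0 : ℕ) ∈ [0]
    simp
  · ext ℓ
    simp

end final

/-- The universality problem for pebble-intervals automata is undecidable, and
so is the inclusion problem. -/
theorem pia_universality_inclusion_undecidable :
    ¬ ComputablePred (fun c : PIACode =>
        ∀ w : List Bool, (codeToPIA c).Accepts w) ∧
    ¬ ComputablePred (fun p : PIACode × PIACode =>
        ∀ w : List Bool, (codeToPIA p.1).Accepts w → (codeToPIA p.2).Accepts w) := by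
  refine ⟨univ_undec, fun hincl => univ_undec ?_⟩
  refine ComputablePred.computable_of_manyOneReducible ⟨fun c => (uCode, c), ?_, ?_⟩ hincl
  · exact Computable.pair (Computable.const uCode) Computable.id
  · intro c
    exact ⟨fun h w _ => h w, fun h w => h w (uCode_accepts w)⟩
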